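/- Let H = (V, E) be a finite simple graph and let k ≥ 4 be an integer with |V| + |E| ≥ k². In the avg-EQ reduction instance built from (H, k), under avg-EQ utilities, the coalition structure Γ is not core-stable if and only if H contains a clique of size k. -/

import Mathlib

open Finset
open scoped Classical

section AHGDefs

variable {N : Type*} [Fintype N] [DecidableEq N]

/-- The set of friends of player `i` inside coalition `C`. -/
noncomputable def friendsIn (G : SimpleGraph N) (C : Finset N) (i : N) : Finset N :=
  C.filter fun j => G.Adj i j

/-- The friend-oriented valuation of coalition `C` by player `i`:
`val_i(C) = n·|F_i ∩ C| − |E_i ∩ C|`. -/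
noncomputable def fval (G : SimpleGraph N) (C : Finset N) (i : N) : ℤ :=
  (Fintype.card N : ℤ) * ((friendsIn G C i).card : ℤ)
    - ((C.filter fun j => ¬ G.Adj i j ∧ j ≠ i).card : ℤ)

/-- Average-based equal-treatment utility. -/
noncomputable def utilAvgEQ (G : SimpleGraph N) (C : Finset N) (i : N) : ℚ :=
  (∑ c ∈ insert i (friendsIn G C i), (fval G C c : ℚ)) /
    ((insert i (friendsIn G C i)).card : ℚ)

/-- Average-based altruistic-treatment utility with weight `w`. -/
noncomputable def utilAvgAL (G : SimpleGraph N) (w : ℚ) (C : Finset N) (i : N) : ℚ :=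
  (fval G C i : ℚ) +
    w * (if (friendsIn G C i).Nonempty then
          (∑ c ∈ friendsIn G C i, (fval G C c : ℚ)) / ((friendsIn G C i).card : ℚ)
         else 0)

/-- Min-based equal-treatment utility. -/
noncomputable def utilMinEQ (G : SimpleGraph N) (C : Finset N) (i : N) : ℤ :=
  (insert i (friendsIn G C i)).inf' (insert_nonempty _ _) (fval G C)

/-- Min-based altruistic-treatment utility with weight `w`. -/
noncomputable def utilMinAL (G : SimpleGraph N) (w : ℤ) (C : Finset N) (i : N) : ℤ :=
  fval G C i +
    w * (if h : (friendsIn G C i).Nonempty then (friendsIn G C i).inf' h (fval G C) else 0)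

/-- A coalition structure (partition of the players), given as the map sending
each player to its coalition. -/
structure CoalitionStructure (N : Type*) [Fintype N] [DecidableEq N] where
  part : N → Finset N
  mem_part : ∀ i, i ∈ part i
  part_eq : ∀ i j, j ∈ part i → part j = part i

/-- A (nonempty) coalition `C` blocks the coalition structure `Γ`. -/
def Blocks {α : Type*} [LT α] (util : Finset N → N → α) (Γ : CoalitionStructure N)
    (C : Finset N) : Prop :=
  C.Nonempty ∧ ∀ i ∈ C, util (Γ.part i) i < util C i

/-- Core stability: no nonempty coalition blocks `Γ`. -/
def CoreStable {α : Type*} [LT α] (util : Finset N → N → α)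
    (Γ : CoalitionStructure N) : Prop :=
  ¬ ∃ C : Finset N, Blocks util Γ C

/-- The base clique of a `(d,k')`-dome gadget on `P` with top player `top`
and mid players `mid`. -/
noncomputable def domeBase {d : ℕ} (P : Finset N) (top : N) (mid : Fin d → N) : Finset N :=
  P \ insert top (Finset.univ.image mid)

/-- `P` carries a `(d,k')`-dome gadget of the graph `G`, with top player `top`,
mid players `mid i` and fringe players `fringe i`. -/
structure IsDomeGadget (G : SimpleGraph N) (d k' : ℕ) (P : Finset N) (top : N)
    (mid fringe : Fin d → N) : Prop where
  card_eq : P.card = k'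
  top_mem : top ∈ P
  mid_mem : ∀ i, mid i ∈ P
  mid_inj : Function.Injective mid
  mid_ne_top : ∀ i, mid i ≠ top
  fringe_mem : ∀ i, fringe i ∈ domeBase P top mid
  fringe_inj : Function.Injective fringe
  adj_iff : ∀ x ∈ P, ∀ y ∈ P, (G.Adj x y ↔
    ((x = top ∧ ∃ i, y = mid i) ∨ (y = top ∧ ∃ i, x = mid i) ∨
     (x ∈ domeBase P top mid ∧ y ∈ domeBase P top mid ∧ x ≠ y) ∨
     (∃ i, (x = mid i ∧ y = fringe i) ∨ (y = mid i ∧ x = fringe i))))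

/-- `P` carries a `(d,k')`-dome gadget with top player `top` (mid and fringe
players existentially quantified). -/
def HasDomeGadget (G : SimpleGraph N) (d k' : ℕ) (P : Finset N) (top : N) : Prop :=
  ∃ mid fringe : Fin d → N, IsDomeGadget G d k' P top mid fringe

/-- The gadget size `k' = k + 3·(k choose 2) + 1` of the average-based reductions. -/
def avgK' (k : ℕ) : ℕ := k + 3 * Nat.choose k 2 + 1

variable {V : Type*} [Fintype V] [DecidableEq V]

/-- `Γ` is the coalition structure of the average-based reduction instances: its
coalitions are exactly the gadget player sets. -/
def IsAvgGamma (H : SimpleGraph V) (Pv : V → Finset N) (Pe : Sym2 V → Finset N)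
    (Pve : V → Sym2 V → Finset N) (Γ : CoalitionStructure N) : Prop :=
  (∀ v : V, ∀ i ∈ Pv v, Γ.part i = Pv v) ∧
  (∀ e ∈ H.edgeSet, ∀ i ∈ Pe e, Γ.part i = Pe e) ∧
  (∀ (v : V), ∀ e ∈ H.edgeSet, v ∈ e → ∀ i ∈ Pve v e, Γ.part i = Pve v e)

/-- The avg-EQ reduction instance built from the graph `H` and `k ≥ 4`:
`G` is the constructed network of friends; `Pv v` carries a `(k−1,k')`-dome gadget
with top player `vp v`, `Pe e` a `(2,k')`-dome gadget with top player `ep e`, and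
`Pve v e` a `(2,k')`-dome gadget with top player `bp v e`. Each `bp v e` is further
adjacent to `vp v` and `ep e`, and there are no other edges. -/
structure AvgEQReduction (H : SimpleGraph V) (k : ℕ) (G : SimpleGraph N)
    (Pv : V → Finset N) (Pe : Sym2 V → Finset N) (Pve : V → Sym2 V → Finset N)
    (vp : V → N) (ep : Sym2 V → N) (bp : V → Sym2 V → N) : Prop where
  dome_v : ∀ v : V, HasDomeGadget G (k - 1) (avgK' k) (Pv v) (vp v)
  dome_e : ∀ e ∈ H.edgeSet, HasDomeGadget G 2 (avgK' k) (Pe e) (ep e)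
  dome_ve : ∀ (v : V), ∀ e ∈ H.edgeSet, v ∈ e →
    HasDomeGadget G 2 (avgK' k) (Pve v e) (bp v e)
  disj_vv : ∀ v w : V, v ≠ w → Disjoint (Pv v) (Pv w)
  disj_ee : ∀ e ∈ H.edgeSet, ∀ f ∈ H.edgeSet, e ≠ f → Disjoint (Pe e) (Pe f)
  disj_bb : ∀ (v : V), ∀ e ∈ H.edgeSet, v ∈ e → ∀ (w : V), ∀ f ∈ H.edgeSet, w ∈ f →
    (v, e) ≠ (w, f) → Disjoint (Pve v e) (Pve w f)
  disj_v_e : ∀ (v : V), ∀ e ∈ H.edgeSet, Disjoint (Pv v) (Pe e)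
  disj_v_b : ∀ (v w : V), ∀ f ∈ H.edgeSet, w ∈ f → Disjoint (Pv v) (Pve w f)
  disj_e_b : ∀ e ∈ H.edgeSet, ∀ (w : V), ∀ f ∈ H.edgeSet, w ∈ f →
    Disjoint (Pe e) (Pve w f)
  cover : ∀ x : N, (∃ v : V, x ∈ Pv v) ∨ (∃ e ∈ H.edgeSet, x ∈ Pe e) ∨
    (∃ (v : V), ∃ e ∈ H.edgeSet, v ∈ e ∧ x ∈ Pve v e)
  adj_bv : ∀ (v : V), ∀ e ∈ H.edgeSet, v ∈ e → G.Adj (bp v e) (vp v)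
  adj_be : ∀ (v : V), ∀ e ∈ H.edgeSet, v ∈ e → G.Adj (bp v e) (ep e)
  adj_cases : ∀ x y : N, G.Adj x y →
    (∃ v : V, x ∈ Pv v ∧ y ∈ Pv v) ∨
    (∃ e ∈ H.edgeSet, x ∈ Pe e ∧ y ∈ Pe e) ∨
    (∃ (v : V), ∃ e ∈ H.edgeSet, v ∈ e ∧ x ∈ Pve v e ∧ y ∈ Pve v e) ∨
    (∃ (v : V), ∃ e ∈ H.edgeSet, v ∈ e ∧
      ((x = bp v e ∧ y = vp v) ∨ (y = bp v e ∧ x = vp v))) ∨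
    (∃ (v : V), ∃ e ∈ H.edgeSet, v ∈ e ∧
      ((x = bp v e ∧ y = ep e) ∨ (y = bp v e ∧ x = ep e)))
end AHGDefs

set_option linter.unusedSectionVars false

section FriendCount

variable {N : Type*} [Fintype N] [DecidableEq N] (G : SimpleGraph N)

/-- The number of friends of player `i` inside coalition `C`. -/
noncomputable def friendCount (C : Finset N) (i : N) : ℕ := (friendsIn G C i).card

/-- The sum of the friend counts of `i` and of its friends inside coalition `C`. -/
noncomputable def friendCountSum (C : Finset N) (i : N) : ℕ :=
  ∑ c ∈ insert i (friendsIn G C i), friendCount G C c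

variable {G}

theorem mem_friendsIn {C : Finset N} {i j : N} : j ∈ friendsIn G C i ↔ j ∈ C ∧ G.Adj i j := by
  simp [friendsIn]

theorem notMem_friendsIn_self {C : Finset N} {i : N} : i ∉ friendsIn G C i := by
  simp [mem_friendsIn]

theorem friendCountSum_eq (C : Finset N) (i : N) :
    friendCountSum G C i = friendCount G C i + ∑ c ∈ friendsIn G C i, friendCount G C c := by
  rw [friendCountSum, sum_insert notMem_friendsIn_self]

theorem fval_eq {C : Finset N} {i : N} (hi : i ∈ C) :
    fval G C i = ((Fintype.card N : ℤ) + 1) * friendCount G C i - ((C.card : ℤ) - 1) := by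
  have h : C = insert i (friendsIn G C i ∪ C.filter fun j => ¬ G.Adj i j ∧ j ≠ i) := by
    ext j
    simp only [mem_insert, mem_union, mem_friendsIn, mem_filter]
    by_cases hj : j = i
    · simp [hj, hi]
    · by_cases ha : G.Adj i j <;> simp [hj, ha]
  have hc : C.card = (friendsIn G C i).card + (C.filter fun j => ¬ G.Adj i j ∧ j ≠ i).card + 1 := by
    conv_lhs => rw [h]
    rw [card_insert_of_notMem, card_union_of_disjoint]
    · rw [disjoint_left]
      intro j hj hj'
      exact (mem_filter.1 hj').2.1 (mem_friendsIn.1 hj).2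
    · simp [mem_friendsIn]
  rw [fval, friendCount, hc]
  push_cast
  ring

theorem utilAvgEQ_eq {C : Finset N} {i : N} (hi : i ∈ C) :
    utilAvgEQ G C i = ((Fintype.card N : ℚ) + 1) *
      ((friendCountSum G C i : ℚ) / ((friendCount G C i : ℚ) + 1)) - ((C.card : ℚ) - 1) := by
  have hsum : ∑ c ∈ insert i (friendsIn G C i), (fval G C c : ℚ) =
      ((Fintype.card N : ℚ) + 1) * friendCountSum G C i
        - ((friendCount G C i : ℚ) + 1) * ((C.card : ℚ) - 1) := by
    have : ∀ c ∈ insert i (friendsIn G C i), (fval G C c : ℚ) =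
        ((Fintype.card N : ℚ) + 1) * friendCount G C c - ((C.card : ℚ) - 1) := by
      intro c hc
      have hcC : c ∈ C := by
        rcases mem_insert.1 hc with rfl | hc
        · exact hi
        · exact (mem_friendsIn.1 hc).1
      rw [fval_eq hcC]
      push_cast
      ring
    rw [sum_congr rfl this, sum_sub_distrib, ← mul_sum, sum_const,
      card_insert_of_notMem notMem_friendsIn_self, friendCountSum, friendCount]
    simp
  rw [utilAvgEQ, hsum, card_insert_of_notMem notMem_friendsIn_self, ← friendCount]
  have : ((friendCount G C i : ℚ) + 1) ≠ 0 := by positivity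
  push_cast
  field_simp

theorem utilAvgEQ_lt_iff {P C : Finset N} {i : N} (hP : i ∈ P) (hC : i ∈ C) :
    utilAvgEQ G P i < utilAvgEQ G C i ↔
      ((Fintype.card N : ℤ) + 1) *
        ((friendCountSum G P i : ℤ) * (friendCount G C i + 1)
          - friendCountSum G C i * (friendCount G P i + 1)) <
      ((P.card : ℤ) - C.card) * ((friendCount G C i + 1) * (friendCount G P i + 1)) := by
  rw [utilAvgEQ_eq hP, utilAvgEQ_eq hC]
  have h1 : (0 : ℚ) < (friendCount G P i : ℚ) + 1 := by positivity
  have h2 : (0 : ℚ) < (friendCount G C i : ℚ) + 1 := by positivity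
  rw [← @Int.cast_lt ℚ]
  push_cast
  rw [← sub_pos, ← sub_pos (b := (_ : ℚ) * (_ - _))]
  rw [← mul_pos_iff_of_pos_right (mul_pos h2 h1)]
  apply iff_of_eq
  congr 1
  field_simp
  ring

theorem weak_block {n k k' c s m s' m' : ℤ} (hn : k' * k ^ 2 ≤ n) (hk' : 0 < k') (hc : 0 < c)
    (hm : 0 < m) (hm' : 0 < m')
    (h : (n + 1) * (s' * m - s * m') < (k' - c) * (m * m')) :
    k ^ 2 * (s' * m - s * m') < m * m' := by
  have hmm : 0 < m * m' := mul_pos hm hm'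
  by_contra hcon
  have hpos : 0 < s' * m - s * m' := by
    by_contra h0
    nlinarith [mul_nonneg (sq_nonneg k) (sub_nonneg.2 (not_lt.1 h0))]
  nlinarith [mul_le_mul_of_nonneg_right hn hpos.le]

end FriendCount

section Dome

variable {N : Type*} [Fintype N] [DecidableEq N] {G : SimpleGraph N} {d k' : ℕ}
  {P : Finset N} {top : N} {mid fringe : Fin d → N}

theorem mem_domeBase {x : N} :
    x ∈ domeBase P top mid ↔ x ∈ P ∧ x ≠ top ∧ ∀ i, mid i ≠ x := by
  simp [domeBase]

/-- The base players in `C` whose mid player also lies in `C`. -/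
noncomputable def linkedBase (P : Finset N) (top : N) (mid fringe : Fin d → N) (C : Finset N) :
    Finset N :=
  (domeBase P top mid ∩ C).filter fun x => ∃ i, fringe i = x ∧ mid i ∈ C

namespace IsDomeGadget

variable (hD : IsDomeGadget G d k' P top mid fringe)
  (hloc : ∀ x ∈ P, x ≠ top → ∀ y, G.Adj x y → y ∈ P)
include hD

theorem card_domeBase : (domeBase P top mid).card + d + 1 = k' := by
  have hsub : insert top (Finset.univ.image mid) ⊆ P := by
    intro x hx
    simp only [mem_insert, mem_image, mem_univ, true_and] at hx
    rcases hx with rfl | ⟨i, rfl⟩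
    exacts [hD.top_mem, hD.mid_mem i]
  have h := card_sdiff_add_card_eq_card hsub
  rw [card_insert_of_notMem, card_image_of_injective _ hD.mid_inj, card_univ, Fintype.card_fin,
    hD.card_eq] at h
  · rw [domeBase]
    omega
  · simp only [mem_image, mem_univ, true_and, not_exists]
    exact hD.mid_ne_top

theorem mem_cases {x : N} (hx : x ∈ P) : x = top ∨ (∃ i, x = mid i) ∨ x ∈ domeBase P top mid := by
  rw [mem_domeBase]
  by_cases h1 : x = top
  · exact .inl h1
  · by_cases h2 : ∃ i, x = mid i
    · exact .inr (.inl h2)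
    · push Not at h2
      exact .inr (.inr ⟨hx, h1, fun i => (h2 i).symm⟩)

theorem top_adj {y : N} (hy : y ∈ P) : G.Adj top y ↔ ∃ i, y = mid i := by
  rw [hD.adj_iff _ hD.top_mem _ hy]
  have h1 := hD.mid_ne_top
  have h2 := fun i => (mem_domeBase.1 (hD.fringe_mem i)).2.1
  have h3 : top ∉ domeBase P top mid := fun h => (mem_domeBase.1 h).2.1 rfl
  constructor
  · rintro (h | ⟨-, i, h⟩ | h | ⟨i, h | h⟩)
    · exact h.2
    · exact absurd h.symm (h1 i)
    · exact absurd h.1 h3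
    · exact absurd h.1.symm (h1 i)
    · exact absurd h.2.symm (h2 i)
  · exact fun h => .inl ⟨rfl, h⟩

include hloc

theorem mid_adj {i : Fin d} {y : N} : G.Adj (mid i) y ↔ y = top ∨ y = fringe i := by
  have h1 := hD.mid_ne_top
  have h2 := fun i => (mem_domeBase.1 (hD.fringe_mem i)).2.2
  have h3 : mid i ∉ domeBase P top mid := fun h => (mem_domeBase.1 h).2.2 i rfl
  constructor
  · intro h
    have hy := hloc _ (hD.mid_mem i) (h1 i) _ h
    rw [hD.adj_iff _ (hD.mid_mem i) _ hy] at h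
    rcases h with h | h | h | ⟨j, h | h⟩
    · exact absurd h.1 (h1 i)
    · exact .inl h.1
    · exact absurd h.1 h3
    · rw [hD.mid_inj h.1]
      exact .inr h.2
    · exact absurd h.2 (h2 j i)
  · rintro (rfl | rfl)
    · exact (hD.adj_iff _ (hD.mid_mem i) _ hD.top_mem).2 (.inr (.inl ⟨rfl, i, rfl⟩))
    · exact (hD.adj_iff _ (hD.mid_mem i) _ (mem_domeBase.1 (hD.fringe_mem i)).1).2
        (.inr (.inr (.inr ⟨i, .inl ⟨rfl, rfl⟩⟩)))

theorem base_adj {x y : N} (hx : x ∈ domeBase P top mid) :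
    G.Adj x y ↔ (y ∈ domeBase P top mid ∧ x ≠ y) ∨ ∃ i, y = mid i ∧ fringe i = x := by
  have hx' := mem_domeBase.1 hx
  constructor
  · intro h
    have hy := hloc _ hx'.1 hx'.2.1 _ h
    rw [hD.adj_iff _ hx'.1 _ hy] at h
    rcases h with h | ⟨-, i, h⟩ | h | ⟨i, h | h⟩
    · exact absurd h.1 hx'.2.1
    · exact absurd h.symm (hx'.2.2 i)
    · exact .inl h.2
    · exact absurd h.1.symm (hx'.2.2 i)
    · exact .inr ⟨i, h.1, h.2.symm⟩
  · rintro (⟨hy, hxy⟩ | ⟨i, rfl, rfl⟩)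
    · exact (hD.adj_iff _ hx'.1 _ (mem_domeBase.1 hy).1).2 (.inr (.inr (.inl ⟨hx, hy, hxy⟩)))
    · exact ((hD.mid_adj hloc).2 (.inr rfl)).symm

theorem friendsIn_base_of_notMem {C : Finset N} {x : N} (hx : x ∈ domeBase P top mid)
    (h : ∀ i, fringe i = x → mid i ∉ C) :
    friendsIn G C x = (domeBase P top mid ∩ C).erase x := by
  ext y
  rw [mem_friendsIn, hD.base_adj hloc hx, mem_erase, mem_inter]
  grind

theorem friendsIn_fringe {C : Finset N} {i : Fin d} (h : mid i ∈ C) :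
    friendsIn G C (fringe i) = insert (mid i) ((domeBase P top mid ∩ C).erase (fringe i)) := by
  ext y
  rw [mem_friendsIn, hD.base_adj hloc (hD.fringe_mem i), mem_insert, mem_erase, mem_inter]
  have := hD.fringe_inj
  constructor
  · rintro ⟨hy, h | ⟨j, rfl, hj⟩⟩
    · exact .inr ⟨h.2.symm, h.1, hy⟩
    · rw [this hj]
      exact .inl rfl
  · rintro (rfl | h)
    · exact ⟨‹_›, .inr ⟨i, rfl, rfl⟩⟩
    · exact ⟨h.2.2, .inl ⟨h.2.1, h.1.symm⟩⟩

omit hloc in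
theorem mid_notMem_base (i : Fin d) : mid i ∉ domeBase P top mid :=
  fun h => (mem_domeBase.1 h).2.2 i rfl

theorem friendCount_base_of_notMem {C : Finset N} {x : N} (hx : x ∈ domeBase P top mid)
    (hxC : x ∈ C) (h : ∀ i, fringe i = x → mid i ∉ C) :
    friendCount G C x + 1 = (domeBase P top mid ∩ C).card := by
  rw [friendCount, hD.friendsIn_base_of_notMem hloc hx h,
    card_erase_add_one (mem_inter.2 ⟨hx, hxC⟩)]

theorem friendCount_fringe {C : Finset N} {i : Fin d} (hx : fringe i ∈ C) (h : mid i ∈ C) :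
    friendCount G C (fringe i) = (domeBase P top mid ∩ C).card := by
  rw [friendCount, hD.friendsIn_fringe hloc h, card_insert_of_notMem,
    card_erase_add_one (mem_inter.2 ⟨hD.fringe_mem i, hx⟩)]
  simp [hD.mid_notMem_base i]

theorem sum_friendCount_base (C : Finset N) :
    ∑ c ∈ domeBase P top mid ∩ C, friendCount G C c + (domeBase P top mid ∩ C).card =
      (domeBase P top mid ∩ C).card * (domeBase P top mid ∩ C).card
        + (linkedBase P top mid fringe C).card := by
  have h : ∀ c ∈ domeBase P top mid ∩ C, friendCount G C c + 1 = (domeBase P top mid ∩ C).card +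
      if ∃ i, fringe i = c ∧ mid i ∈ C then 1 else 0 := by
    intro c hc
    have hc' := mem_inter.1 hc
    split_ifs with hl
    · obtain ⟨i, rfl, hi⟩ := hl
      rw [hD.friendCount_fringe hloc hc'.2 hi]
    · push Not at hl
      rw [hD.friendCount_base_of_notMem hloc hc'.1 hc'.2 hl, add_zero]
  have := sum_congr rfl h
  rw [sum_add_distrib, sum_add_distrib, sum_const, sum_const, ← card_filter] at this
  simpa [linkedBase] using this

theorem friendCountSum_base_of_notMem {C : Finset N} {x : N} (hx : x ∈ domeBase P top mid)
    (hxC : x ∈ C) (h : ∀ i, fringe i = x → mid i ∉ C) :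
    friendCountSum G C x + (domeBase P top mid ∩ C).card =
      (domeBase P top mid ∩ C).card * (domeBase P top mid ∩ C).card
        + (linkedBase P top mid fringe C).card := by
  rw [friendCountSum, hD.friendsIn_base_of_notMem hloc hx h,
    insert_erase (mem_inter.2 ⟨hx, hxC⟩), hD.sum_friendCount_base hloc]

theorem friendCountSum_fringe {C : Finset N} {i : Fin d} (hx : fringe i ∈ C) (h : mid i ∈ C) :
    friendCountSum G C (fringe i) + (domeBase P top mid ∩ C).card =
      (domeBase P top mid ∩ C).card * (domeBase P top mid ∩ C).card
        + (linkedBase P top mid fringe C).card + friendCount G C (mid i) := by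
  rw [friendCountSum, hD.friendsIn_fringe hloc h, insert_comm,
    insert_erase (mem_inter.2 ⟨hD.fringe_mem i, hx⟩), sum_insert, ← hD.sum_friendCount_base hloc]
  · ring
  · simp [hD.mid_notMem_base i]

theorem friendsIn_mid_subset (C : Finset N) (i : Fin d) :
    friendsIn G C (mid i) ⊆ {top, fringe i} := by
  intro y hy
  simpa using (hD.mid_adj hloc).1 (mem_friendsIn.1 hy).2

theorem friendCount_mid_le (C : Finset N) (i : Fin d) : friendCount G C (mid i) ≤ 2 :=
  (card_le_card (hD.friendsIn_mid_subset hloc C i)).trans card_le_two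

omit hloc in
theorem top_ne_fringe (i : Fin d) : top ≠ fringe i :=
  (mem_domeBase.1 (hD.fringe_mem i)).2.1.symm

theorem friendsIn_self_mid (i : Fin d) : friendsIn G P (mid i) = {top, fringe i} := by
  ext y
  rw [mem_friendsIn, hD.mid_adj hloc, mem_insert, mem_singleton]
  constructor
  · exact fun h => h.2
  · rintro (rfl | rfl)
    · exact ⟨hD.top_mem, .inl rfl⟩
    · exact ⟨(mem_domeBase.1 (hD.fringe_mem i)).1, .inr rfl⟩

theorem friendCount_self_mid (i : Fin d) : friendCount G P (mid i) = 2 := by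
  rw [friendCount, hD.friendsIn_self_mid hloc, card_pair (hD.top_ne_fringe i)]

omit hloc in
theorem friendsIn_self_top : friendsIn G P top = univ.image mid := by
  ext y
  simp only [mem_friendsIn, mem_image, mem_univ, true_and]
  constructor
  · rintro ⟨hy, h⟩
    obtain ⟨i, rfl⟩ := (hD.top_adj hy).1 h
    exact ⟨i, rfl⟩
  · rintro ⟨i, rfl⟩
    exact ⟨hD.mid_mem i, (hD.top_adj (hD.mid_mem i)).2 ⟨i, rfl⟩⟩

omit hloc in
theorem friendCount_self_top : friendCount G P top = d := by
  rw [friendCount, hD.friendsIn_self_top, card_image_of_injective _ hD.mid_inj, card_univ,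
    Fintype.card_fin]

theorem friendCountSum_self_top : friendCountSum G P top = 3 * d := by
  rw [friendCountSum_eq, hD.friendCount_self_top, hD.friendsIn_self_top,
    sum_image hD.mid_inj.injOn]
  simp only [hD.friendCount_self_mid hloc]
  simp
  ring

omit hloc in
theorem base_inter_self : domeBase P top mid ∩ P = domeBase P top mid :=
  inter_eq_left.2 sdiff_subset

omit hloc in
theorem linkedBase_subset (C : Finset N) : linkedBase P top mid fringe C ⊆ univ.image fringe := by
  intro x hx
  obtain ⟨i, hi, -⟩ := (mem_filter.1 hx).2
  exact mem_image.2 ⟨i, mem_univ _, hi⟩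

omit hloc in
theorem card_image_fringe : (univ.image fringe).card = d := by
  rw [card_image_of_injective _ hD.fringe_inj, card_univ, Fintype.card_fin]

omit hloc in
theorem card_linkedBase_le (C : Finset N) : (linkedBase P top mid fringe C).card ≤ d :=
  (card_le_card (hD.linkedBase_subset C)).trans hD.card_image_fringe.le

omit hloc in
theorem mid_mem_of_card_linkedBase {C : Finset N}
    (h : (linkedBase P top mid fringe C).card = d) (i : Fin d) : mid i ∈ C := by
  have := eq_of_subset_of_card_le (hD.linkedBase_subset C) (by rw [h, hD.card_image_fringe])
  have hi : fringe i ∈ linkedBase P top mid fringe C := this ▸ mem_image_of_mem _ (mem_univ i)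
  obtain ⟨j, hj, hjC⟩ := (mem_filter.1 hi).2
  rwa [← hD.fringe_inj hj]

omit hloc in
theorem card_linkedBase_lt {C : Finset N} {i : Fin d} (h : mid i ∉ C) :
    (linkedBase P top mid fringe C).card < d :=
  lt_of_le_of_ne (hD.card_linkedBase_le C) fun he => h (hD.mid_mem_of_card_linkedBase he i)

omit hloc in
theorem card_linkedBase_self : (linkedBase P top mid fringe P).card = d := by
  refine (congrArg card ?_).trans hD.card_image_fringe
  refine (hD.linkedBase_subset P).antisymm fun x hx => ?_
  obtain ⟨i, -, rfl⟩ := mem_image.1 hx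
  exact mem_filter.2 ⟨hD.base_inter_self.symm ▸ hD.fringe_mem i, i, rfl, hD.mid_mem i⟩

end IsDomeGadget

end Dome

section DomeArithmetic

variable {b t d q k : ℤ}

theorem le_sq_mul_of_le_two_mul {x z : ℤ} (hk : 3 ≤ k) (hx : 0 ≤ x) (h : x ≤ 2 * z) :
    x ≤ k ^ 2 * z := by
  have hk2 : 2 ≤ k ^ 2 := by nlinarith
  exact h.trans (mul_le_mul_of_nonneg_right hk2 (by linarith))

theorem base_deficit (hd : 2 ≤ d) (hk : d + 1 ≤ k) (hb : 4 * k ≤ b) (ht : 1 ≤ t) (htb : t < b)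
    (hq : q ≤ d) :
    b * t ≤ k ^ 2 * ((b * b + d - b) * t - (t * t + q - t) * b) := by
  have h1 : (b - t) * (b * t - d) ≤ (b * b + d - b) * t - (t * t + q - t) * b := by
    nlinarith [mul_nonneg (sub_nonneg.2 hq) (by linarith : 0 ≤ b)]
  have h2 : b ≤ b * t := by nlinarith
  have h3 : b * t - d ≤ (b - t) * (b * t - d) := by nlinarith
  exact le_sq_mul_of_le_two_mul (by linarith) (by nlinarith) (by linarith)

theorem fringe_deficit {m : ℤ} (hd : 2 ≤ d) (hk : d + 1 ≤ k) (hb : 4 * k ≤ b) (ht : 1 ≤ t)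
    (htb : t < b) (hq : q ≤ d) (hm : m ≤ 2) :
    (b + 1) * (t + 1) ≤
      k ^ 2 * ((b * b + d + 2 - b) * (t + 1) - (t * t + q + m - t) * (b + 1)) := by
  have h1 : (b - t) * ((b + 1) * (t + 1) - (d + 4)) ≤
      (b * b + d + 2 - b) * (t + 1) - (t * t + q + m - t) * (b + 1) := by
    nlinarith [mul_nonneg (sub_nonneg.2 hq) (by linarith : 0 ≤ b + 1),
      mul_nonneg (sub_nonneg.2 hm) (by linarith : 0 ≤ b + 1)]
  have h2 : (b + 1) * 2 ≤ (b + 1) * (t + 1) := by nlinarith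
  have h3 : (b + 1) * (t + 1) - (d + 4) ≤ (b - t) * ((b + 1) * (t + 1) - (d + 4)) := by nlinarith
  exact le_sq_mul_of_le_two_mul (by linarith) (by nlinarith) (by linarith)

theorem unlinked_fringe_deficit (hd : 2 ≤ d) (hk : d + 1 ≤ k) (hb : 4 * k ≤ b)
    (hbk : b + 1 ≤ 2 * k ^ 2) (ht : 1 ≤ t) (htb : t < b) (hq : q < d) (hqt : q ≤ t) :
    (b + 1) * t ≤ k ^ 2 * ((b * b + d + 2 - b) * t - (t * t + q - t) * (b + 1)) := by
  rcases (by omega : t = b - 1 ∨ t ≤ b - 2) with rfl | htb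
  · have h1 : b + 1 ≤ (b * b + d + 2 - b) * (b - 1)
        - ((b - 1) * (b - 1) + q - (b - 1)) * (b + 1) - 2 * b := by
      nlinarith [mul_nonneg (by linarith : 0 ≤ d - 1 - q) (by linarith : 0 ≤ b + 1)]
    nlinarith [sq_nonneg k]
  · have h1 : 6 * t ≤ (b * b + d + 2 - b) * t - (t * t + q - t) * (b + 1) := by
      nlinarith [mul_nonneg (sub_nonneg.2 hqt) (by linarith : 0 ≤ b + 1),
        mul_nonneg (mul_nonneg (by linarith : 0 ≤ b - 2 - t) (by linarith : 0 ≤ t))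
          (by linarith : 0 ≤ b + 1)]
    nlinarith [sq_nonneg k]

end DomeArithmetic

section DomeBlocking

variable {N : Type*} [Fintype N] [DecidableEq N] {G : SimpleGraph N} {d k k' : ℕ}
  {P C : Finset N} {top : N} {mid fringe : Fin d → N}

namespace IsDomeGadget

variable (hD : IsDomeGadget G d k' P top mid fringe)
  (hloc : ∀ x ∈ P, x ≠ top → ∀ y, G.Adj x y → y ∈ P)
include hD hloc

theorem friendCount_self_base {x : N} (hx : x ∈ domeBase P top mid) (h : ∀ i, fringe i ≠ x) :
    friendCount G P x + 1 = (domeBase P top mid).card ∧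
    friendCountSum G P x + (domeBase P top mid).card =
      (domeBase P top mid).card * (domeBase P top mid).card + d := by
  have hxP := (mem_domeBase.1 hx).1
  have h1 := hD.friendCount_base_of_notMem hloc hx hxP fun i hi => absurd hi (h i)
  have h2 := hD.friendCountSum_base_of_notMem hloc hx hxP fun i hi => absurd hi (h i)
  rw [hD.base_inter_self] at h1 h2
  rw [hD.card_linkedBase_self] at h2
  exact ⟨h1, h2⟩

theorem friendCount_self_fringe (i : Fin d) :
    friendCount G P (fringe i) = (domeBase P top mid).card ∧
    friendCountSum G P (fringe i) + (domeBase P top mid).card =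
      (domeBase P top mid).card * (domeBase P top mid).card + d + 2 := by
  have hxP := (mem_domeBase.1 (hD.fringe_mem i)).1
  have h1 := hD.friendCount_fringe hloc hxP (hD.mid_mem i)
  have h2 := hD.friendCountSum_fringe hloc hxP (hD.mid_mem i)
  rw [hD.base_inter_self] at h1 h2
  rw [hD.card_linkedBase_self, hD.friendCount_self_mid hloc] at h2
  exact ⟨h1, h2⟩

variable (hd : 2 ≤ d) (hdk : d + 1 ≤ k) (hb : 4 * k ≤ (domeBase P top mid).card)
  (hk' : k' ≤ 2 * k ^ 2) (hn : k' * k ^ 2 ≤ Fintype.card N)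
  (hblk : ∀ i ∈ C, i ∈ P → utilAvgEQ G P i < utilAvgEQ G C i)
include hd hdk hb hk' hn hblk

theorem domeBase_subset_of_blocks {x : N} (hx : x ∈ domeBase P top mid) (hxC : x ∈ C) :
    domeBase P top mid ⊆ C := by
  have hxP := (mem_domeBase.1 hx).1
  have hblk' := (utilAvgEQ_lt_iff hxP hxC).1 (hblk x hxC hxP)
  rw [hD.card_eq] at hblk'
  have hcard := hD.card_domeBase
  have hCpos : 0 < C.card := card_pos.2 ⟨x, hxC⟩
  have hw := weak_block (k := k) (by exact_mod_cast hn) (by omega) (by exact_mod_cast hCpos)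
    (by positivity) (by positivity) hblk'
  have htpos : 0 < (domeBase P top mid ∩ C).card := card_pos.2 ⟨x, mem_inter.2 ⟨hx, hxC⟩⟩
  have hq := hD.card_linkedBase_le C
  have hqt : (linkedBase P top mid fringe C).card ≤ (domeBase P top mid ∩ C).card :=
    card_le_card (filter_subset _ _)
  by_contra hsub
  have htb : (domeBase P top mid ∩ C).card < (domeBase P top mid).card := by
    refine lt_of_le_of_ne (card_le_card inter_subset_left) fun he => hsub ?_
    rw [← inter_eq_left]
    exact eq_of_subset_of_card_le inter_subset_left he.ge
  have e1 : (k' : ℤ) ≤ 2 * (k : ℤ) ^ 2 := by exact_mod_cast hk'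
  by_cases hf : ∃ i, fringe i = x
  · obtain ⟨i, rfl⟩ := hf
    obtain ⟨p1, p2⟩ := hD.friendCount_self_fringe hloc i
    by_cases hi : mid i ∈ C
    · have c1 := hD.friendCount_fringe hloc hxC hi
      have c2 := hD.friendCountSum_fringe hloc hxC hi
      have c3 := hD.friendCount_mid_le hloc C i
      generalize (domeBase P top mid ∩ C).card = t at *
      generalize (domeBase P top mid).card = b at *
      generalize (linkedBase P top mid fringe C).card = q at *
      generalize friendCount G C (mid i) = m at *
      have := fringe_deficit (b := b) (t := t) (d := d) (q := q) (k := k) (m := m)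
        (by omega) (by omega) (by omega) (by omega) (by omega) (by omega) (by omega)
      rw [p1, c1] at hw
      rw [(by omega : (friendCountSum G P (fringe i) : ℤ) = b * b + d + 2 - b),
        (by omega : (friendCountSum G C (fringe i) : ℤ) = t * t + q + m - t)] at hw
      linarith [mul_comm ((b : ℤ) + 1) (t + 1)]
    · have hu : ∀ j, fringe j = fringe i → mid j ∉ C := fun j hj => by rwa [hD.fringe_inj hj]
      have c1 := hD.friendCount_base_of_notMem hloc hx hxC hu
      have c2 := hD.friendCountSum_base_of_notMem hloc hx hxC hu
      have hq' := hD.card_linkedBase_lt hi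
      generalize (domeBase P top mid ∩ C).card = t at *
      generalize (domeBase P top mid).card = b at *
      generalize (linkedBase P top mid fringe C).card = q at *
      have := unlinked_fringe_deficit (b := b) (t := t) (d := d) (q := q) (k := k)
        (by omega) (by omega) (by omega) (by omega) (by omega) (by omega) (by omega) (by omega)
      rw [p1, (by omega : (friendCount G C (fringe i) : ℤ) + 1 = t)] at hw
      rw [(by omega : (friendCountSum G P (fringe i) : ℤ) = b * b + d + 2 - b),
        (by omega : (friendCountSum G C (fringe i) : ℤ) = t * t + q - t)] at hw
      linarith [mul_comm ((b : ℤ) + 1) t]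
  · push Not at hf
    obtain ⟨p1, p2⟩ := hD.friendCount_self_base hloc hx hf
    have c1 := hD.friendCount_base_of_notMem hloc hx hxC fun i hi => absurd hi (hf i)
    have c2 := hD.friendCountSum_base_of_notMem hloc hx hxC fun i hi => absurd hi (hf i)
    generalize (domeBase P top mid ∩ C).card = t at *
    generalize (domeBase P top mid).card = b at *
    generalize (linkedBase P top mid fringe C).card = q at *
    have := base_deficit (b := b) (t := t) (d := d) (q := q) (k := k)
      (by omega) (by omega) (by omega) (by omega) (by omega) (by omega)
    rw [(by omega : (friendCount G P x : ℤ) + 1 = b),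
      (by omega : (friendCount G C x : ℤ) + 1 = t)] at hw
    rw [(by omega : (friendCountSum G P x : ℤ) = b * b + d - b),
      (by omega : (friendCountSum G C x : ℤ) = t * t + q - t)] at hw
    linarith [mul_comm (b : ℤ) t]

theorem disjoint_domeBase_of_blocks : ∀ x ∈ domeBase P top mid, x ∉ C := by
  intro x hx hxC
  have hsub := hD.domeBase_subset_of_blocks hloc hd hdk hb hk' hn hblk hx hxC
  have hinter : domeBase P top mid ∩ C = domeBase P top mid := inter_eq_left.2 hsub
  have hcard := hD.card_domeBase
  obtain ⟨y, hy, hyf⟩ : ∃ y ∈ domeBase P top mid, y ∉ univ.image fringe := by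
    by_contra! h
    have := card_le_card h
    rw [hD.card_image_fringe] at this
    omega
  have hyf' : ∀ i, fringe i ≠ y := fun i hi => hyf (hi ▸ mem_image_of_mem _ (mem_univ i))
  have hyP := (mem_domeBase.1 hy).1
  have hblky := (utilAvgEQ_lt_iff hyP (hsub hy)).1 (hblk y (hsub hy) hyP)
  obtain ⟨p1, p2⟩ := hD.friendCount_self_base hloc hy hyf'
  have c1 := hD.friendCount_base_of_notMem hloc hy (hsub hy) fun i hi => absurd hi (hyf' i)
  have c2 := hD.friendCountSum_base_of_notMem hloc hy (hsub hy) fun i hi => absurd hi (hyf' i)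
  have hq := hD.card_linkedBase_le C
  have hkk : k ≤ k ^ 2 := Nat.le_self_pow two_ne_zero k
  have hnk : k' ≤ Fintype.card N := le_trans (Nat.le_mul_of_pos_right _ (by omega)) hn
  have hbC := card_le_card hsub
  rw [hinter] at c1 c2
  rw [hD.card_eq, (by omega : (friendCount G P y : ℤ) + 1 = (domeBase P top mid).card),
      (by omega : (friendCount G C y : ℤ) + 1 = (domeBase P top mid).card), ← sub_mul,
      ← mul_assoc, ← mul_assoc] at hblky
  replace hblky := lt_of_mul_lt_mul_right hblky (Int.natCast_nonneg _)
  have hqd : (linkedBase P top mid fringe C).card = d := by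
    by_contra hne
    rw [(by omega : (friendCountSum G P y : ℤ) - friendCountSum G C y =
      d - (linkedBase P top mid fringe C).card)] at hblky
    have e1 : ((Fintype.card N : ℤ) + 1) * 1 ≤
        ((Fintype.card N : ℤ) + 1) * (d - (linkedBase P top mid fringe C).card) :=
      mul_le_mul_of_nonneg_left (by omega) (by positivity)
    have e2 : ((k' : ℤ) - C.card) * (domeBase P top mid).card ≤ k * k' := by
      have : ((k' : ℤ) - C.card) ≤ k := by omega
      calc ((k' : ℤ) - C.card) * (domeBase P top mid).card
          ≤ k * (domeBase P top mid).card := mul_le_mul_of_nonneg_right this (by positivity)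
        _ ≤ k * k' := mul_le_mul_of_nonneg_left (by omega) (by positivity)
    have e3 : (k : ℤ) * k' ≤ Fintype.card N := by
      have : k' * k ≤ k' * k ^ 2 := Nat.mul_le_mul_left _ hkk
      have := this.trans hn
      rw [mul_comm] at this
      exact_mod_cast this
    linarith
  have hmid := hD.mid_mem_of_card_linkedBase hqd
  have hPtop : P.erase top ⊆ C := by
    intro z hz
    obtain ⟨hzt, hzP⟩ := mem_erase.1 hz
    rcases hD.mem_cases hzP with rfl | ⟨i, rfl⟩ | hz
    exacts [absurd rfl hzt, hmid i, hsub hz]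
  have hCcard : k' ≤ C.card + 1 := by
    have := card_le_card hPtop
    rw [card_erase_of_mem hD.top_mem, hD.card_eq] at this
    omega
  have htop : top ∉ C := by
    intro htop
    have hPC : P ⊆ C := by
      intro z hz
      by_cases hzt : z = top
      exacts [hzt ▸ htop, hPtop (mem_erase.2 ⟨hzt, hz⟩)]
    have := card_le_card hPC
    rw [hD.card_eq] at this
    rw [(by omega : (friendCountSum G P y : ℤ) - friendCountSum G C y = 0), mul_zero] at hblky
    have : ((k' : ℤ) - C.card) * (domeBase P top mid).card ≤ 0 :=
      mul_nonpos_of_nonpos_of_nonneg (by omega) (by positivity)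
    linarith
  let i : Fin d := ⟨0, by omega⟩
  have hfC := hsub (hD.fringe_mem i)
  have hfP := (mem_domeBase.1 (hD.fringe_mem i)).1
  have hblkf := (utilAvgEQ_lt_iff hfP hfC).1 (hblk _ hfC hfP)
  obtain ⟨p1, p2⟩ := hD.friendCount_self_fringe hloc i
  have c1 := hD.friendCount_fringe hloc hfC (hmid i)
  have c2 := hD.friendCountSum_fringe hloc hfC (hmid i)
  have c3 : friendCount G C (mid i) ≤ 1 := by
    rw [friendCount]
    refine (card_le_card (t := {fringe i}) fun z hz => ?_).trans (card_singleton _).le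
    have hz' := hD.friendsIn_mid_subset hloc C i hz
    rw [mem_insert, mem_singleton] at hz'
    rcases hz' with rfl | rfl
    exacts [absurd (mem_friendsIn.1 hz).1 htop, mem_singleton_self _]
  rw [hinter] at c1 c2
  rw [hD.card_eq, p1, c1, ← sub_mul, ← mul_assoc, ← mul_assoc] at hblkf
  replace hblkf := lt_of_mul_lt_mul_right hblkf (by positivity)
  have e1 : ((Fintype.card N : ℤ) + 1) * 1 ≤ ((Fintype.card N : ℤ) + 1) *
      ((friendCountSum G P (fringe i) : ℤ) - friendCountSum G C (fringe i)) :=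
    mul_le_mul_of_nonneg_left (by omega) (by positivity)
  have e2 : ((k' : ℤ) - C.card) * ((domeBase P top mid).card + 1) ≤
      1 * ((domeBase P top mid).card + 1) :=
    mul_le_mul_of_nonneg_right (by omega) (by positivity)
  have e3 : ((domeBase P top mid).card : ℤ) + 1 ≤ Fintype.card N := by omega
  linarith

theorem friendsIn_mid_subset_top_of_blocks (i : Fin d) : friendsIn G C (mid i) ⊆ {top} := by
  intro z hz
  have hz' := hD.friendsIn_mid_subset hloc C i hz
  rw [mem_insert, mem_singleton] at hz'
  rcases hz' with rfl | rfl
  · exact mem_singleton_self _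
  · exact absurd (mem_friendsIn.1 hz).1
      (hD.disjoint_domeBase_of_blocks hloc hd hdk hb hk' hn hblk _ (hD.fringe_mem i))

theorem friendCount_mid_le_one_of_blocks (i : Fin d) : friendCount G C (mid i) ≤ 1 :=
  (card_le_card (hD.friendsIn_mid_subset_top_of_blocks hloc hd hdk hb hk' hn hblk i)).trans
    (card_singleton _).le

omit hd hdk hb hk' hn hblk in
theorem card_le_friendCountSum_self_mid (i : Fin d) :
    (domeBase P top mid).card ≤ friendCountSum G P (mid i) := by
  rw [← (hD.friendCount_self_fringe hloc i).1, friendCountSum]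
  refine single_le_sum (f := friendCount G P) (fun _ _ => Nat.zero_le _) (mem_insert_of_mem ?_)
  rw [hD.friendsIn_self_mid hloc]
  simp

/-- A mid player in a blocking coalition needs a top player with more than four friends. -/
theorem mid_mem_of_blocks {i : Fin d} (hi : mid i ∈ C) : top ∈ C ∧ 4 < friendCount G C top := by
  have hiP := hD.mid_mem i
  have hblk' := (utilAvgEQ_lt_iff hiP hi).1 (hblk _ hi hiP)
  rw [hD.card_eq] at hblk'
  have hcard := hD.card_domeBase
  have hw := weak_block (k := k) (by exact_mod_cast hn) (by omega)
    (by exact_mod_cast card_pos.2 ⟨_, hi⟩) (by positivity) (by positivity) hblk'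
  have hp := hD.card_le_friendCountSum_self_mid hloc i
  have hsub := hD.friendsIn_mid_subset_top_of_blocks hloc hd hdk hb hk' hn hblk i
  rw [hD.friendCount_self_mid hloc] at hw
  have hk9 : 9 ≤ k ^ 2 := by nlinarith
  by_contra hcon
  rcases subset_singleton_iff.1 hsub with he | he
  · have e1 : friendCount G C (mid i) = 0 := by rw [friendCount, he, card_empty]
    have e2 : friendCountSum G C (mid i) = 0 := by simp [friendCountSum_eq, e1, he]
    rw [e1, e2] at hw
    push_cast at hw
    nlinarith
  · have htop : top ∈ C := (mem_friendsIn.1 (he ▸ mem_singleton_self top)).1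
    have e1 : friendCount G C (mid i) = 1 := by rw [friendCount, he, card_singleton]
    have e2 : friendCountSum G C (mid i) = 1 + friendCount G C top := by
      simp [friendCountSum_eq, e1, he]
    have e3 : friendCount G C top ≤ 4 := by
      by_contra h
      exact hcon ⟨htop, by omega⟩
    rw [e1, e2] at hw
    push_cast at hw
    have e4 : (1 : ℤ) * 9 ≤ k ^ 2 * (friendCountSum G P (mid i) * (1 + 1) -
        (1 + friendCount G C top) * (2 + 1)) := by
      rw [mul_comm]
      exact mul_le_mul (by exact_mod_cast hk9) (by omega) (by norm_num) (by positivity)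
    linarith

end IsDomeGadget

end DomeBlocking

section AvgConstants

theorem two_mul_choose_two_add (k : ℕ) : 2 * k.choose 2 + k = k ^ 2 := by
  have h := Nat.div_mul_cancel (Nat.even_mul_pred_self k).two_dvd
  rw [← Nat.choose_two_right] at h
  cases k with
  | zero => simp
  | succ j =>
    rw [Nat.add_sub_cancel] at h
    linarith [h, (by ring : (j + 1) ^ 2 = (j + 1) * j + (j + 1))]

theorem two_mul_avgK'_add (k : ℕ) : 2 * avgK' k + k = 3 * k ^ 2 + 2 := by
  have := two_mul_choose_two_add k
  rw [avgK']
  omega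

theorem avgK'_le {k : ℕ} (hk : 4 ≤ k) : avgK' k ≤ 2 * k ^ 2 := by
  have := two_mul_avgK'_add k
  have : 4 * k ≤ k ^ 2 := by nlinarith
  omega

theorem four_mul_le_of_add_eq_avgK' {b d k : ℕ} (hk : 4 ≤ k) (hd : d + 1 ≤ k)
    (h : b + d + 1 = avgK' k) : 4 * k ≤ b := by
  have := two_mul_avgK'_add k
  have : 4 * k ≤ k ^ 2 := by nlinarith
  omega

end AvgConstants

section TopOnly

variable {N : Type*} [Fintype N] [DecidableEq N] {G : SimpleGraph N} {k k' : ℕ}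
  {P C : Finset N} {top : N} {mid fringe : Fin 2 → N}

/-- If the top player of a `(2,k')`-dome gadget has at most two friends outside the gadget, then
a blocking coalition meets the gadget at most in its top player. -/
theorem IsDomeGadget.eq_top_of_blocks (hD : IsDomeGadget G 2 k' P top mid fringe)
    (hloc : ∀ x ∈ P, x ≠ top → ∀ y, G.Adj x y → y ∈ P) {a b : N}
    (htop : ∀ y, G.Adj top y → y ∈ P ∨ y = a ∨ y = b)
    (hk : 3 ≤ k) (hb : 4 * k ≤ (domeBase P top mid).card)
    (hk' : k' ≤ 2 * k ^ 2) (hn : k' * k ^ 2 ≤ Fintype.card N)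
    (hblk : ∀ i ∈ C, i ∈ P → utilAvgEQ G P i < utilAvgEQ G C i) :
    ∀ x ∈ C, x ∈ P → x = top := by
  intro x hxC hxP
  rcases hD.mem_cases hxP with h | ⟨i, rfl⟩ | h
  · exact h
  · have h4 := (hD.mid_mem_of_blocks hloc le_rfl hk hb hk' hn hblk hxC).2
    have hsub : friendsIn G C top ⊆ univ.image mid ∪ {a, b} := by
      intro y hy
      rw [mem_union]
      have hy' := (mem_friendsIn.1 hy).2
      rcases htop y hy' with h | h
      · obtain ⟨j, rfl⟩ := (hD.top_adj h).1 hy'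
        exact .inl (mem_image_of_mem _ (mem_univ j))
      · exact .inr (by simpa using h)
    have h1 := (card_le_card hsub).trans (card_union_le _ _)
    have h2 : (univ.image mid).card ≤ 2 := card_image_le.trans (by simp)
    have h3 : ({a, b} : Finset N).card ≤ 2 := card_le_two
    rw [friendCount] at h4
    omega
  · exact absurd hxC (hD.disjoint_domeBase_of_blocks hloc le_rfl hk hb hk' hn hblk x h)

end TopOnly

namespace AvgEQReduction

variable {V N : Type*} [Fintype V] [DecidableEq V] [Fintype N] [DecidableEq N]
  {H : SimpleGraph V} {k : ℕ} {G : SimpleGraph N} {Pv : V → Finset N} {Pe : Sym2 V → Finset N}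
  {Pve : V → Sym2 V → Finset N} {vp : V → N} {ep : Sym2 V → N} {bp : V → Sym2 V → N}
  (R : AvgEQReduction H k G Pv Pe Pve vp ep bp)
include R

theorem vp_mem (v : V) : vp v ∈ Pv v := by
  obtain ⟨mid, fringe, hD⟩ := R.dome_v v
  exact hD.top_mem

theorem ep_mem {e : Sym2 V} (he : e ∈ H.edgeSet) : ep e ∈ Pe e := by
  obtain ⟨mid, fringe, hD⟩ := R.dome_e e he
  exact hD.top_mem

theorem bp_mem {v : V} {e : Sym2 V} (he : e ∈ H.edgeSet) (hv : v ∈ e) : bp v e ∈ Pve v e := by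
  obtain ⟨mid, fringe, hD⟩ := R.dome_ve v e he hv
  exact hD.top_mem

theorem Pv_inj {v w : V} {x : N} (hx : x ∈ Pv v) (hx' : x ∈ Pv w) : v = w := by
  by_contra h
  exact disjoint_left.1 (R.disj_vv v w h) hx hx'

theorem Pe_inj {e f : Sym2 V} (he : e ∈ H.edgeSet) (hf : f ∈ H.edgeSet) {x : N} (hx : x ∈ Pe e)
    (hx' : x ∈ Pe f) : e = f := by
  by_contra h
  exact disjoint_left.1 (R.disj_ee e he f hf h) hx hx'

theorem Pve_inj {v w : V} {e f : Sym2 V} (he : e ∈ H.edgeSet) (hv : v ∈ e) (hf : f ∈ H.edgeSet)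
    (hw : w ∈ f) {x : N} (hx : x ∈ Pve v e) (hx' : x ∈ Pve w f) : v = w ∧ e = f := by
  by_contra h
  refine disjoint_left.1 (R.disj_bb v e he hv w f hf hw fun h' => h ?_) hx hx'
  exact Prod.mk.inj h'

theorem notMem_Pe {v : V} {e : Sym2 V} (he : e ∈ H.edgeSet) {x : N} (hx : x ∈ Pv v) : x ∉ Pe e :=
  disjoint_left.1 (R.disj_v_e v e he) hx

theorem notMem_Pve {v w : V} {e : Sym2 V} (he : e ∈ H.edgeSet) (hw : w ∈ e) {x : N}
    (hx : x ∈ Pv v) : x ∉ Pve w e :=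
  disjoint_left.1 (R.disj_v_b v w e he hw) hx

theorem notMem_Pve_of_mem_Pe {w : V} {e f : Sym2 V} (he : e ∈ H.edgeSet) (hf : f ∈ H.edgeSet)
    (hw : w ∈ f) {x : N} (hx : x ∈ Pe e) : x ∉ Pve w f :=
  disjoint_left.1 (R.disj_e_b e he w f hf hw) hx

theorem vp_inj : Function.Injective vp := fun v w h =>
  R.Pv_inj (R.vp_mem v) (h ▸ R.vp_mem w)

theorem ep_inj {e f : Sym2 V} (he : e ∈ H.edgeSet) (hf : f ∈ H.edgeSet) (h : ep e = ep f) :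
    e = f :=
  R.Pe_inj he hf (R.ep_mem he) (h ▸ R.ep_mem hf)

theorem bp_inj {v w v' w' : V} (h : H.Adj v w) (h' : H.Adj v' w')
    (he : bp v s(v, w) = bp v' s(v', w')) : v = v' ∧ w = w' := by
  obtain ⟨rfl, h2⟩ := R.Pve_inj (H.mem_edgeSet.2 h) (Sym2.mem_mk_left v w) (H.mem_edgeSet.2 h')
    (Sym2.mem_mk_left v' w') (R.bp_mem (H.mem_edgeSet.2 h) (Sym2.mem_mk_left v w))
    (he ▸ R.bp_mem (H.mem_edgeSet.2 h') (Sym2.mem_mk_left v' w'))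
  exact ⟨rfl, Sym2.congr_right.1 h2⟩

theorem adj_of_mem_Pv {v : V} {x y : N} (hx : x ∈ Pv v) (h : G.Adj x y) :
    y ∈ Pv v ∨ (x = vp v ∧ ∃ w, H.Adj v w ∧ y = bp v s(v, w)) := by
  rcases R.adj_cases x y h with ⟨w, hw, hy⟩ | ⟨e, he, hxe, -⟩ | ⟨w, e, he, hw, hxe, -⟩ |
    ⟨w, e, he, hw, ⟨rfl, rfl⟩ | ⟨rfl, rfl⟩⟩ | ⟨w, e, he, hw, ⟨rfl, rfl⟩ | ⟨rfl, rfl⟩⟩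
  · exact .inl (R.Pv_inj hx hw ▸ hy)
  · exact absurd hxe (R.notMem_Pe he hx)
  · exact absurd hxe (R.notMem_Pve he hw hx)
  · exact absurd (R.bp_mem he hw) (R.notMem_Pve he hw hx)
  · obtain rfl := R.Pv_inj hx (R.vp_mem w)
    obtain ⟨u, rfl⟩ := Sym2.mem_iff_exists.1 hw
    exact .inr ⟨rfl, u, he, rfl⟩
  · exact absurd (R.bp_mem he hw) (R.notMem_Pve he hw hx)
  · exact absurd (R.ep_mem he) (R.notMem_Pe he hx)

theorem adj_of_mem_Pe {u w : V} (huw : H.Adj u w) {x y : N} (hx : x ∈ Pe s(u, w))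
    (h : G.Adj x y) :
    y ∈ Pe s(u, w) ∨ (x = ep s(u, w) ∧ (y = bp u s(u, w) ∨ y = bp w s(u, w))) := by
  have hE := H.mem_edgeSet.2 huw
  rcases R.adj_cases x y h with ⟨v, hv, -⟩ | ⟨e, he, hxe, hy⟩ | ⟨v, e, he, hv, hxe, -⟩ |
    ⟨v, e, he, hv, ⟨rfl, rfl⟩ | ⟨rfl, rfl⟩⟩ | ⟨v, e, he, hv, ⟨rfl, rfl⟩ | ⟨rfl, rfl⟩⟩
  · exact absurd hx (R.notMem_Pe hE hv)
  · exact .inl (R.Pe_inj he hE hxe hx ▸ hy)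
  · exact absurd hxe (R.notMem_Pve_of_mem_Pe hE he hv hx)
  · exact absurd (R.bp_mem he hv) (R.notMem_Pve_of_mem_Pe hE he hv hx)
  · exact absurd hx (R.notMem_Pe hE (R.vp_mem v))
  · exact absurd (R.bp_mem he hv) (R.notMem_Pve_of_mem_Pe hE he hv hx)
  · obtain rfl := R.Pe_inj he hE (R.ep_mem he) hx
    rcases Sym2.mem_iff.1 hv with rfl | rfl
    exacts [.inr ⟨rfl, .inl rfl⟩, .inr ⟨rfl, .inr rfl⟩]

theorem adj_of_mem_Pve {u w : V} (huw : H.Adj u w) {x y : N} (hx : x ∈ Pve u s(u, w))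
    (h : G.Adj x y) :
    y ∈ Pve u s(u, w) ∨ (x = bp u s(u, w) ∧ (y = vp u ∨ y = ep s(u, w))) := by
  have hE := H.mem_edgeSet.2 huw
  have hu := Sym2.mem_mk_left u w
  rcases R.adj_cases x y h with ⟨v, hv, -⟩ | ⟨e, he, hxe, -⟩ | ⟨v, e, he, hv, hxe, hy⟩ |
    ⟨v, e, he, hv, ⟨rfl, rfl⟩ | ⟨rfl, rfl⟩⟩ | ⟨v, e, he, hv, ⟨rfl, rfl⟩ | ⟨rfl, rfl⟩⟩
  · exact absurd hx (R.notMem_Pve hE hu hv)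
  · exact absurd hx (R.notMem_Pve_of_mem_Pe he hE hu hxe)
  · obtain ⟨rfl, rfl⟩ := R.Pve_inj he hv hE hu hxe hx
    exact .inl hy
  · obtain ⟨rfl, rfl⟩ := R.Pve_inj he hv hE hu (R.bp_mem he hv) hx
    exact .inr ⟨rfl, .inl rfl⟩
  · exact absurd hx (R.notMem_Pve hE hu (R.vp_mem v))
  · obtain ⟨rfl, rfl⟩ := R.Pve_inj he hv hE hu (R.bp_mem he hv) hx
    exact .inr ⟨rfl, .inr rfl⟩
  · exact absurd hx (R.notMem_Pve_of_mem_Pe he hE hu (R.ep_mem he))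

theorem mul_card_le_card : avgK' k * (Fintype.card V + H.edgeFinset.card) ≤ Fintype.card N := by
  have h1 : (univ.biUnion Pv).card = Fintype.card V * avgK' k := by
    rw [card_biUnion fun v _ w _ h => R.disj_vv v w h, sum_congr rfl (g := fun _ => avgK' k)]
    · simp
    · intro v _
      obtain ⟨mid, fringe, hD⟩ := R.dome_v v
      exact hD.card_eq
  have h2 : (H.edgeFinset.biUnion Pe).card = H.edgeFinset.card * avgK' k := by
    rw [card_biUnion fun e he f hf h => R.disj_ee e (by simpa using he) f (by simpa using hf) h,
      sum_congr rfl (g := fun _ => avgK' k)]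
    · simp
    · intro e he
      obtain ⟨mid, fringe, hD⟩ := R.dome_e e (by simpa using he)
      exact hD.card_eq
  have h3 : Disjoint (univ.biUnion Pv) (H.edgeFinset.biUnion Pe) := by
    simp only [disjoint_biUnion_left, disjoint_biUnion_right]
    intro e he v _
    exact R.disj_v_e v e (by simpa using he)
  rw [mul_comm, add_mul, ← h1, ← h2, ← card_union_of_disjoint h3]
  exact card_le_univ _

/-- The friend counts and their sums for the top players inside their own gadgets. -/
theorem friendCount_vp (v : V) :
    friendCount G (Pv v) (vp v) = k - 1 ∧ friendCountSum G (Pv v) (vp v) = 3 * (k - 1) := by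
  obtain ⟨mid, fringe, hD⟩ := R.dome_v v
  refine ⟨hD.friendCount_self_top, hD.friendCountSum_self_top fun x hx hne y hxy => ?_⟩
  exact (R.adj_of_mem_Pv hx hxy).resolve_right fun h => hne h.1

theorem friendCount_ep {u w : V} (huw : H.Adj u w) :
    friendCount G (Pe s(u, w)) (ep s(u, w)) = 2 ∧
      friendCountSum G (Pe s(u, w)) (ep s(u, w)) = 6 := by
  obtain ⟨mid, fringe, hD⟩ := R.dome_e _ (H.mem_edgeSet.2 huw)
  refine ⟨hD.friendCount_self_top, hD.friendCountSum_self_top fun x hx hne y hxy => ?_⟩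
  exact (R.adj_of_mem_Pe huw hx hxy).resolve_right fun h => hne h.1

theorem friendCount_bp {u w : V} (huw : H.Adj u w) :
    friendCount G (Pve u s(u, w)) (bp u s(u, w)) = 2 ∧
      friendCountSum G (Pve u s(u, w)) (bp u s(u, w)) = 6 := by
  obtain ⟨mid, fringe, hD⟩ := R.dome_ve _ _ (H.mem_edgeSet.2 huw) (Sym2.mem_mk_left u w)
  refine ⟨hD.friendCount_self_top, hD.friendCountSum_self_top fun x hx hne y hxy => ?_⟩
  exact (R.adj_of_mem_Pve huw hx hxy).resolve_right fun h => hne h.1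

theorem friendsIn_ep_subset {C : Finset N} {u w : V} (huw : H.Adj u w)
    (hC : ∀ x ∈ C, x ∈ Pe s(u, w) → x = ep s(u, w)) :
    friendsIn G C (ep s(u, w)) ⊆ {bp u s(u, w), bp w s(u, w)} := by
  intro y hy
  obtain ⟨hyC, hadj⟩ := mem_friendsIn.1 hy
  rcases R.adj_of_mem_Pe huw (R.ep_mem huw) hadj with h | h
  · exact absurd (hC y hyC h) hadj.ne'
  · simpa using h.2

theorem friendsIn_bp_subset {C : Finset N} {u w : V} (huw : H.Adj u w)
    (hC : ∀ x ∈ C, x ∈ Pve u s(u, w) → x = bp u s(u, w)) :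
    friendsIn G C (bp u s(u, w)) ⊆ {vp u, ep s(u, w)} := by
  intro y hy
  obtain ⟨hyC, hadj⟩ := mem_friendsIn.1 hy
  rcases R.adj_of_mem_Pve huw (R.bp_mem huw (Sym2.mem_mk_left u w)) hadj with h | h
  · exact absurd (hC y hyC h) hadj.ne'
  · simpa using h.2

theorem vp_ne_ep (v : V) {e : Sym2 V} (he : e ∈ H.edgeSet) : vp v ≠ ep e := fun h =>
  R.notMem_Pe he (R.vp_mem v) (h ▸ R.ep_mem he)

theorem vp_ne_bp (v w : V) {e : Sym2 V} (he : e ∈ H.edgeSet) (hw : w ∈ e) : vp v ≠ bp w e :=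
  fun h => R.notMem_Pve he hw (R.vp_mem v) (h ▸ R.bp_mem he hw)

theorem ep_ne_bp (w : V) {e f : Sym2 V} (he : e ∈ H.edgeSet) (hf : f ∈ H.edgeSet) (hw : w ∈ f) :
    ep e ≠ bp w f :=
  fun h => R.notMem_Pve_of_mem_Pe he hf hw (R.ep_mem he) (h ▸ R.bp_mem hf hw)

theorem bp_ne_bp {u w : V} (huw : H.Adj u w) : bp u s(u, w) ≠ bp w s(u, w) := by
  rw [Sym2.eq_swap (a := u) (b := w)]
  nth_rw 1 [Sym2.eq_swap]
  exact fun h => huw.ne (R.bp_inj huw huw.symm h).1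

end AvgEQReduction

section TopArithmetic

theorem sub_one_le_of_degree_bound {k D S a : ℤ} (hk : 4 ≤ k) (haD : a ≤ D)
    (hS : S ≤ 2 * D + a)
    (h : k ^ 2 * (3 * (k - 1) * (D + 1) - S * k) < (D + 1) * k) : k - 1 ≤ a := by
  by_contra! hlt
  have h1 : (k - 3) * (D - a) + 3 * (k - 1 - a) ≤ 3 * (k - 1) * (D + 1) - S * k := by
    nlinarith [mul_nonneg (sub_nonneg.2 hS) (by linarith : 0 ≤ k)]
  have h2 : (D - a) + 3 ≤ 3 * (k - 1) * (D + 1) - S * k := by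
    nlinarith [mul_nonneg (by linarith : 0 ≤ k - 4) (sub_nonneg.2 haD)]
  have h3 : D + 1 ≤ k * (3 * (k - 1) * (D + 1) - S * k) := by
    nlinarith [mul_nonneg (by linarith : 0 ≤ k - 4) (sub_nonneg.2 haD)]
  nlinarith

end TopArithmetic

namespace AvgEQReduction

section Blocking

variable {V N : Type*} [Fintype V] [DecidableEq V] [Fintype N] [DecidableEq N]
  {H : SimpleGraph V} {k : ℕ} {G : SimpleGraph N} {Pv : V → Finset N} {Pe : Sym2 V → Finset N}
  {Pve : V → Sym2 V → Finset N} {vp : V → N} {ep : Sym2 V → N} {bp : V → Sym2 V → N}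
  (R : AvgEQReduction H k G Pv Pe Pve vp ep bp) (hk : 4 ≤ k)
  (hsize : k ^ 2 ≤ Fintype.card V + H.edgeFinset.card)
  {Γ : CoalitionStructure N} (hΓ : IsAvgGamma H Pv Pe Pve Γ) {C : Finset N}
  (hC : Blocks (utilAvgEQ G) Γ C)

include R hsize in
theorem avgK'_mul_sq_le_card : avgK' k * k ^ 2 ≤ Fintype.card N :=
  (Nat.mul_le_mul_left _ hsize).trans R.mul_card_le_card

include hk hsize hΓ hC

include R in
theorem eq_ep_of_blocks {u w : V} (huw : H.Adj u w) : ∀ x ∈ C, x ∈ Pe s(u, w) → x = ep s(u, w) := by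
  obtain ⟨mid, fringe, hD⟩ := R.dome_e _ (H.mem_edgeSet.2 huw)
  refine hD.eq_top_of_blocks (k := k) (a := bp u s(u, w)) (b := bp w s(u, w)) ?_ ?_ (by omega)
    (four_mul_le_of_add_eq_avgK' hk (by omega) hD.card_domeBase) (avgK'_le hk)
    (R.avgK'_mul_sq_le_card hsize) ?_
  · exact fun x hx hne y hxy => (R.adj_of_mem_Pe huw hx hxy).resolve_right fun h => hne h.1
  · exact fun y hy => (R.adj_of_mem_Pe huw hD.top_mem hy).imp_right And.right
  · intro i hi hiP
    simpa only [hΓ.2.1 _ (H.mem_edgeSet.2 huw) i hiP] using hC.2 i hi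

include R in
theorem eq_bp_of_blocks {u w : V} (huw : H.Adj u w) :
    ∀ x ∈ C, x ∈ Pve u s(u, w) → x = bp u s(u, w) := by
  have hu := Sym2.mem_mk_left u w
  obtain ⟨mid, fringe, hD⟩ := R.dome_ve _ _ (H.mem_edgeSet.2 huw) hu
  refine hD.eq_top_of_blocks (k := k) (a := vp u) (b := ep s(u, w)) ?_ ?_ (by omega)
    (four_mul_le_of_add_eq_avgK' hk (by omega) hD.card_domeBase) (avgK'_le hk)
    (R.avgK'_mul_sq_le_card hsize) ?_
  · exact fun x hx hne y hxy => (R.adj_of_mem_Pve huw hx hxy).resolve_right fun h => hne h.1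
  · exact fun y hy => (R.adj_of_mem_Pve huw hD.top_mem hy).imp_right And.right
  · intro i hi hiP
    simpa only [hΓ.2.2 _ _ (H.mem_edgeSet.2 huw) hu i hiP] using hC.2 i hi

include R in
/-- A vertex gadget meets a blocking coalition only in its top player and in mid players that
have at most one friend in the coalition and whose top player is also present. -/
theorem eq_vp_or_of_blocks {v : V} : ∀ x ∈ C, x ∈ Pv v →
    x = vp v ∨ (vp v ∈ C ∧ friendCount G C x ≤ 1) := by
  intro x hxC hxP
  obtain ⟨mid, fringe, hD⟩ := R.dome_v v
  have hloc : ∀ x ∈ Pv v, x ≠ vp v → ∀ y, G.Adj x y → y ∈ Pv v :=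
    fun x hx hne y hxy => (R.adj_of_mem_Pv hx hxy).resolve_right fun h => hne h.1
  have hb : 4 * k ≤ (domeBase (Pv v) (vp v) mid).card :=
    four_mul_le_of_add_eq_avgK' hk (by omega) hD.card_domeBase
  have hn := R.avgK'_mul_sq_le_card hsize
  have hblk : ∀ i ∈ C, i ∈ Pv v → utilAvgEQ G (Pv v) i < utilAvgEQ G C i := by
    intro i hi hiP
    simpa only [hΓ.1 v i hiP] using hC.2 i hi
  rcases hD.mem_cases hxP with h | ⟨i, rfl⟩ | h
  · exact .inl h
  · exact .inr ⟨(hD.mid_mem_of_blocks hloc (by omega) (by omega) hb (avgK'_le hk) hn hblk hxC).1,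
      hD.friendCount_mid_le_one_of_blocks hloc (by omega) (by omega) hb (avgK'_le hk) hn hblk i⟩
  · exact absurd hxC
      (hD.disjoint_domeBase_of_blocks hloc (by omega) (by omega) hb (avgK'_le hk) hn hblk x h)

include R in
theorem friendCount_bp_le_two {u w : V} (huw : H.Adj u w) :
    friendCount G C (bp u s(u, w)) ≤ 2 :=
  (card_le_card (R.friendsIn_bp_subset huw (R.eq_bp_of_blocks hk hsize hΓ hC huw))).trans
    card_le_two

include R in
theorem ep_mem_of_blocks {u w : V} (huw : H.Adj u w) (he : ep s(u, w) ∈ C) :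
    C.card < avgK' k ∧ bp u s(u, w) ∈ C ∧ vp u ∈ C := by
  have hE := H.mem_edgeSet.2 huw
  have heP := R.ep_mem hE
  obtain ⟨mid, fringe, hD⟩ := R.dome_e _ hE
  have hblk := hC.2 _ he
  rw [hΓ.2.1 _ hE _ heP, utilAvgEQ_lt_iff heP he, hD.card_eq, (R.friendCount_ep huw).1,
    (R.friendCount_ep huw).2] at hblk
  have hw := weak_block (k := k) (by exact_mod_cast R.avgK'_mul_sq_le_card hsize)
    (by rw [avgK']; positivity) (by exact_mod_cast card_pos.2 ⟨_, he⟩) (by positivity)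
    (by positivity) hblk
  have hsub := R.friendsIn_ep_subset huw (R.eq_ep_of_blocks hk hsize hΓ hC huw)
  have hne := R.bp_ne_bp huw
  have hle : friendCount G C (ep s(u, w)) ≤ 2 := (card_le_card hsub).trans card_le_two
  have hu := R.friendCount_bp_le_two hk hsize hΓ hC huw
  have hw' := R.friendCount_bp_le_two hk hsize hΓ hC huw.symm
  rw [Sym2.eq_swap] at hw'
  have hsum : friendCountSum G C (ep s(u, w)) ≤ 3 * friendCount G C (ep s(u, w)) := by
    have : ∑ c ∈ friendsIn G C (ep s(u, w)), friendCount G C c ≤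
        (friendsIn G C (ep s(u, w))).card • 2 := by
      refine sum_le_card_nsmul _ _ _ fun c hc => ?_
      have := hsub hc
      rw [mem_insert, mem_singleton] at this
      rcases this with rfl | rfl
      exacts [hu, hw']
    rw [friendCountSum_eq]
    rw [smul_eq_mul, ← friendCount] at this
    omega
  have hk2 : 16 ≤ k ^ 2 := by nlinarith
  have hlow : 2 * (friendCount G C (ep s(u, w)) + 1) ≤ friendCountSum G C (ep s(u, w)) := by
    by_contra! hlt
    have e1 : (16 : ℤ) * 3 ≤ k ^ 2 * ((6 : ℕ) * (friendCount G C (ep s(u, w)) + 1) -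
        friendCountSum G C (ep s(u, w)) * ((2 : ℕ) + 1)) :=
      mul_le_mul (by exact_mod_cast hk2) (by push_cast; omega) (by norm_num) (by positivity)
    push_cast at e1 hw
    omega
  have h2 : friendCount G C (ep s(u, w)) = 2 := by omega
  have h6 : friendCountSum G C (ep s(u, w)) = 6 := by omega
  have heq : friendsIn G C (ep s(u, w)) = {bp u s(u, w), bp w s(u, w)} := by
    refine eq_of_subset_of_card_le hsub ?_
    rw [← friendCount, h2]
    exact card_le_two
  have hu2 : friendCount G C (bp u s(u, w)) = 2 := by
    rw [friendCountSum_eq, h2, heq, sum_pair hne] at h6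
    omega
  have hueq : friendsIn G C (bp u s(u, w)) = {vp u, ep s(u, w)} := by
    refine eq_of_subset_of_card_le
      (R.friendsIn_bp_subset huw (R.eq_bp_of_blocks hk hsize hΓ hC huw)) ?_
    rw [← friendCount, hu2]
    exact card_le_two
  refine ⟨?_, (mem_friendsIn.1 (heq ▸ mem_insert_self _ _)).1,
    (mem_friendsIn.1 (hueq ▸ mem_insert_self _ _)).1⟩
  rw [h2, h6] at hblk
  push_cast at hblk
  omega

include R in
theorem vp_mem_of_bp_mem {u w : V} (huw : H.Adj u w) (hb : bp u s(u, w) ∈ C) : vp u ∈ C := by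
  by_contra hv
  have hE := H.mem_edgeSet.2 huw
  have hu := Sym2.mem_mk_left u w
  have hbP := R.bp_mem hE hu
  obtain ⟨mid, fringe, hD⟩ := R.dome_ve _ _ hE hu
  have hblk := hC.2 _ hb
  rw [hΓ.2.2 _ _ hE hu _ hbP, utilAvgEQ_lt_iff hbP hb, hD.card_eq, (R.friendCount_bp huw).1,
    (R.friendCount_bp huw).2] at hblk
  have hw := weak_block (k := k) (by exact_mod_cast R.avgK'_mul_sq_le_card hsize)
    (by rw [avgK']; positivity) (by exact_mod_cast card_pos.2 ⟨_, hb⟩) (by positivity)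
    (by positivity) hblk
  have he : friendsIn G C (bp u s(u, w)) = ∅ := by
    refine eq_empty_of_forall_notMem fun y hy => ?_
    have hyC := (mem_friendsIn.1 hy).1
    have := R.friendsIn_bp_subset huw (R.eq_bp_of_blocks hk hsize hΓ hC huw) hy
    rw [mem_insert, mem_singleton] at this
    rcases this with rfl | rfl
    exacts [hv hyC, hv (R.ep_mem_of_blocks hk hsize hΓ hC huw hyC).2.2]
  have h0 : friendCount G C (bp u s(u, w)) = 0 := by rw [friendCount, he, card_empty]
  have hs0 : friendCountSum G C (bp u s(u, w)) = 0 := by simp [friendCountSum_eq, h0, he]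
  have hk2 : 16 ≤ k ^ 2 := by nlinarith
  rw [h0, hs0] at hw
  push_cast at hw
  zify at hk2
  linarith

include R in
theorem exists_vp_mem_of_blocks : ∃ v, vp v ∈ C := by
  obtain ⟨x, hx⟩ := hC.1
  rcases R.cover x with ⟨v, hxv⟩ | ⟨e, he, hxe⟩ | ⟨v, e, he, hv, hxe⟩
  · rcases R.eq_vp_or_of_blocks hk hsize hΓ hC x hx hxv with rfl | h
    exacts [⟨v, hx⟩, ⟨v, h.1⟩]
  · induction e using Sym2.ind with
    | _ u w =>
      obtain rfl := R.eq_ep_of_blocks hk hsize hΓ hC he x hx hxe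
      exact ⟨u, (R.ep_mem_of_blocks hk hsize hΓ hC he hx).2.2⟩
  · obtain ⟨w, rfl⟩ := Sym2.mem_iff_exists.1 hv
    obtain rfl := R.eq_bp_of_blocks hk hsize hΓ hC he x hx hxe
    exact ⟨v, R.vp_mem_of_bp_mem hk hsize hΓ hC he hx⟩

omit hk hsize hΓ hC

/-- The neighbors of `v` in `H` along edges whose edge player belongs to `C`. -/
noncomputable def selectedNeighbors (H : SimpleGraph V) (ep : Sym2 V → N) (C : Finset N) (v : V) :
    Finset V :=
  univ.filter fun w => H.Adj v w ∧ ep s(v, w) ∈ C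

theorem mem_selectedNeighbors {v w : V} :
    w ∈ selectedNeighbors H ep C v ↔ H.Adj v w ∧ ep s(v, w) ∈ C := by
  simp [selectedNeighbors]

include hk hsize hΓ hC

include R in
theorem card_selectedNeighbors_ge {v : V} (hv : vp v ∈ C) :
    k - 1 ≤ (selectedNeighbors H ep C v).card := by
  have hvP := R.vp_mem v
  obtain ⟨mid, fringe, hD⟩ := R.dome_v v
  have hblk := hC.2 _ hv
  rw [hΓ.1 _ _ hvP, utilAvgEQ_lt_iff hvP hv, hD.card_eq, (R.friendCount_vp v).1,
    (R.friendCount_vp v).2] at hblk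
  have hw := weak_block (k := k) (by exact_mod_cast R.avgK'_mul_sq_le_card hsize)
    (by rw [avgK']; positivity) (by exact_mod_cast card_pos.2 ⟨_, hv⟩) (by positivity)
    (by positivity) hblk
  set I := (selectedNeighbors H ep C v).image fun w => bp v s(v, w) with hI
  have hIcard : I.card = (selectedNeighbors H ep C v).card :=
    card_image_of_injOn fun w hw w' hw' h =>
      (R.bp_inj (mem_selectedNeighbors.1 hw).1 (mem_selectedNeighbors.1 hw').1 h).2
  have hIsub : I ⊆ friendsIn G C (vp v) := by
    intro y hy
    obtain ⟨w, hw, rfl⟩ := mem_image.1 hy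
    obtain ⟨hvw, he⟩ := mem_selectedNeighbors.1 hw
    exact mem_friendsIn.2 ⟨(R.ep_mem_of_blocks hk hsize hΓ hC hvw he).2.1,
      (R.adj_bv v _ hvw (Sym2.mem_mk_left v w)).symm⟩
  have hcount : ∀ y ∈ friendsIn G C (vp v), friendCount G C y ≤ 1 + if y ∈ I then 1 else 0 := by
    intro y hy
    obtain ⟨hyC, hadj⟩ := mem_friendsIn.1 hy
    rcases R.adj_of_mem_Pv hvP hadj with hyP | ⟨-, w, hvw, rfl⟩
    · rcases R.eq_vp_or_of_blocks hk hsize hΓ hC y hyC hyP with h | h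
      · exact absurd h hadj.ne'
      · exact h.2.trans (Nat.le_add_right _ _)
    · by_cases he : ep s(v, w) ∈ C
      · rw [if_pos (mem_image.2 ⟨w, mem_selectedNeighbors.2 ⟨hvw, he⟩, rfl⟩)]
        exact R.friendCount_bp_le_two hk hsize hΓ hC hvw
      · refine le_trans ?_ (Nat.le_add_right _ _)
        refine (card_le_card (t := {vp v}) fun z hz => ?_).trans (card_singleton _).le
        have := R.friendsIn_bp_subset hvw (R.eq_bp_of_blocks hk hsize hΓ hC hvw) hz
        rw [mem_insert, mem_singleton] at this
        rcases this with rfl | rfl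
        exacts [mem_singleton_self _, absurd (mem_friendsIn.1 hz).1 he]
  have hS : friendCountSum G C (vp v) ≤
      2 * friendCount G C (vp v) + (selectedNeighbors H ep C v).card := by
    have := sum_le_sum hcount
    rw [sum_add_distrib, sum_const, ← card_filter, filter_mem_eq_inter, inter_eq_right.2 hIsub,
      hIcard, ← friendCount, smul_eq_mul, mul_one] at this
    rw [friendCountSum_eq]
    omega
  have haD : (selectedNeighbors H ep C v).card ≤ friendCount G C (vp v) :=
    hIcard ▸ card_le_card hIsub
  push_cast [(by omega : 1 ≤ k)] at hw
  rw [sub_add_cancel] at hw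
  have := sub_one_le_of_degree_bound (k := k) (D := friendCount G C (vp v))
    (S := friendCountSum G C (vp v)) (a := (selectedNeighbors H ep C v).card)
    (by exact_mod_cast hk) (by exact_mod_cast haD) (by exact_mod_cast hS) hw
  omega

include R in
theorem exists_isNClique_of_blocks : ∃ K : Finset V, H.IsNClique k K := by
  obtain ⟨v₀, hv₀⟩ := R.exists_vp_mem_of_blocks hk hsize hΓ hC
  set X : Finset V := univ.filter fun v => vp v ∈ C with hX
  have mem_X : ∀ {v}, v ∈ X ↔ vp v ∈ C := by simp [hX]
  have hdeg : ∀ v ∈ X, k - 1 ≤ (selectedNeighbors H ep C v).card := fun v hv =>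
    R.card_selectedNeighbors_ge hk hsize hΓ hC (mem_X.1 hv)
  have hsub : ∀ v, selectedNeighbors H ep C v ⊆ X.erase v := by
    intro v w hw
    obtain ⟨hvw, he⟩ := mem_selectedNeighbors.1 hw
    rw [Sym2.eq_swap] at he
    exact mem_erase.2 ⟨hvw.ne', mem_X.2 (R.ep_mem_of_blocks hk hsize hΓ hC hvw.symm he).2.2⟩
  have hXk : k ≤ X.card := by
    have h1 := hdeg v₀ (mem_X.2 hv₀)
    have h2 := card_le_card (hsub v₀)
    rw [card_erase_of_mem (mem_X.2 hv₀)] at h2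
    have h3 := card_pos.2 ⟨v₀, mem_X.2 hv₀⟩
    omega
  have hCk : C.card < avgK' k := by
    have h1 := hdeg v₀ (mem_X.2 hv₀)
    obtain ⟨w, hw⟩ := card_pos.1 (by omega : 0 < (selectedNeighbors H ep C v₀).card)
    obtain ⟨hvw, he⟩ := mem_selectedNeighbors.1 hw
    exact (R.ep_mem_of_blocks hk hsize hΓ hC hvw he).1
  set Z : Finset (V × V) := (univ : Finset (V × V)).filter
    fun p => p.1 ∈ X ∧ p.2 ∈ selectedNeighbors H ep C p.1 with hZ
  have mem_Z : ∀ {p}, p ∈ Z ↔ p.1 ∈ X ∧ p.2 ∈ selectedNeighbors H ep C p.1 := by simp [hZ]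
  have hZcard : X.card * (k - 1) ≤ Z.card := by
    have h1 : Z.card = ∑ v ∈ X, (selectedNeighbors H ep C v).card := by
      rw [← card_sigma]
      refine card_bij' (fun p _ => ⟨p.1, p.2⟩) (fun p _ => (p.1, p.2)) ?_ ?_ ?_ ?_ <;>
        simp [mem_Z]
    rw [h1, ← smul_eq_mul]
    exact card_nsmul_le_sum _ _ _ hdeg
  have hZadj : ∀ p ∈ Z, H.Adj p.1 p.2 ∧ ep s(p.1, p.2) ∈ C := fun p hp =>
    mem_selectedNeighbors.1 (mem_Z.1 hp).2
  set Y : Finset (Sym2 V) := Z.image fun p => s(p.1, p.2) with hY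
  have hYE : ∀ e ∈ Y, e ∈ H.edgeSet ∧ ep e ∈ C := by
    intro e he
    obtain ⟨p, hp, rfl⟩ := mem_image.1 he
    exact hZadj p hp
  have hZY : Z.card ≤ 2 * Y.card := by
    refine card_le_mul_card_image _ _ fun e he => ?_
    obtain ⟨q, hq, rfl⟩ := mem_image.1 he
    refine (card_le_card (t := {q, q.swap}) fun p hp => ?_).trans card_le_two
    have := (mem_filter.1 hp).2
    rw [Sym2.eq_iff] at this
    rw [mem_insert, mem_singleton, Prod.ext_iff, Prod.ext_iff]
    exact this
  have hcount : X.card + Y.card + Z.card ≤ C.card := by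
    have h1 : (X.image vp).card = X.card := card_image_of_injective _ R.vp_inj
    have h2 : (Y.image ep).card = Y.card :=
      card_image_of_injOn fun e he f hf h => R.ep_inj (hYE e he).1 (hYE f hf).1 h
    have h3 : (Z.image fun p => bp p.1 s(p.1, p.2)).card = Z.card :=
      card_image_of_injOn fun p hp q hq h =>
        Prod.ext_iff.2 (R.bp_inj (hZadj p hp).1 (hZadj q hq).1 h)
    have d1 : Disjoint (X.image vp) (Y.image ep) := by
      rw [disjoint_left]
      intro x hx hx'
      obtain ⟨v, -, rfl⟩ := mem_image.1 hx
      obtain ⟨e, he, h⟩ := mem_image.1 hx'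
      exact R.vp_ne_ep v (hYE e he).1 h.symm
    have d2 : Disjoint (X.image vp ∪ Y.image ep) (Z.image fun p => bp p.1 s(p.1, p.2)) := by
      rw [disjoint_left]
      intro x hx hx'
      obtain ⟨p, hp, rfl⟩ := mem_image.1 hx'
      have hpE : s(p.1, p.2) ∈ H.edgeSet := (hZadj p hp).1
      rcases mem_union.1 hx with hx | hx
      · obtain ⟨v, -, h⟩ := mem_image.1 hx
        exact R.vp_ne_bp v _ hpE (Sym2.mem_mk_left _ _) h
      · obtain ⟨e, he, h⟩ := mem_image.1 hx
        exact R.ep_ne_bp _ (hYE e he).1 hpE (Sym2.mem_mk_left _ _) h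
    rw [← h1, ← h2, ← h3, ← card_union_of_disjoint d1, ← card_union_of_disjoint d2]
    refine card_le_card fun x hx => ?_
    rcases mem_union.1 hx with hx | hx
    · rcases mem_union.1 hx with hx | hx
      · obtain ⟨v, hv, rfl⟩ := mem_image.1 hx
        exact mem_X.1 hv
      · obtain ⟨e, he, rfl⟩ := mem_image.1 hx
        exact (hYE e he).2
    · obtain ⟨p, hp, rfl⟩ := mem_image.1 hx
      exact (R.ep_mem_of_blocks hk hsize hΓ hC (hZadj p hp).1 (hZadj p hp).2).2.1
  have hXcard : X.card = k := by
    refine le_antisymm ?_ hXk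
    by_contra! hlt
    have h1 := two_mul_avgK'_add k
    have h2 : (k + 1) * (k - 1) ≤ X.card * (k - 1) := Nat.mul_le_mul_right _ hlt
    obtain ⟨j, rfl⟩ : ∃ j, k = j + 1 := ⟨k - 1, by omega⟩
    rw [Nat.add_sub_cancel] at h2 hZcard
    nlinarith
  refine ⟨X, ⟨fun u hu w hw huw => ?_, hXcard⟩⟩
  have heq : selectedNeighbors H ep C u = X.erase u := by
    refine eq_of_subset_of_card_le (hsub u) ?_
    rw [card_erase_of_mem hu, hXcard]
    exact hdeg u hu
  exact (mem_selectedNeighbors.1 (heq ▸ mem_erase.2 ⟨huw.symm, hw⟩)).1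

end Blocking

end AvgEQReduction

section CliqueCoalition

variable {V N : Type*} [Fintype V] [DecidableEq V] [Fintype N] [DecidableEq N]

/-- The vertex players of `K`, the edge players of the pairs in `K`, and the incidence players
joining them. -/
noncomputable def cliqueCoalition (vp : V → N) (ep : Sym2 V → N) (bp : V → Sym2 V → N)
    (K : Finset V) : Finset N :=
  K.image vp ∪ (K.offDiag.image Sym2.mk.uncurry).image ep ∪
    K.offDiag.image fun p => bp p.1 s(p.1, p.2)

theorem mem_cliqueCoalition {vp : V → N} {ep : Sym2 V → N} {bp : V → Sym2 V → N} {K : Finset V}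
    {x : N} : x ∈ cliqueCoalition vp ep bp K ↔
      (∃ v ∈ K, x = vp v) ∨ (∃ u ∈ K, ∃ w ∈ K, u ≠ w ∧ x = ep s(u, w)) ∨
        ∃ u ∈ K, ∃ w ∈ K, u ≠ w ∧ x = bp u s(u, w) := by
  simp only [cliqueCoalition, mem_union, mem_image, mem_offDiag, Prod.exists]
  constructor
  · rintro ((⟨v, hv, rfl⟩ | ⟨e, ⟨u, w, ⟨hu, hw, hne⟩, rfl⟩, rfl⟩) | ⟨u, w, ⟨hu, hw, hne⟩, rfl⟩)
    · exact .inl ⟨v, hv, rfl⟩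
    · exact .inr (.inl ⟨u, hu, w, hw, hne, rfl⟩)
    · exact .inr (.inr ⟨u, hu, w, hw, hne, rfl⟩)
  · rintro (⟨v, hv, rfl⟩ | ⟨u, hu, w, hw, hne, rfl⟩ | ⟨u, hu, w, hw, hne, rfl⟩)
    · exact .inl (.inl ⟨v, hv, rfl⟩)
    · exact .inl (.inr ⟨_, ⟨u, w, ⟨hu, hw, hne⟩, rfl⟩, rfl⟩)
    · exact .inr ⟨u, w, ⟨hu, hw, hne⟩, rfl⟩

theorem card_cliqueCoalition_lt (vp : V → N) (ep : Sym2 V → N) (bp : V → Sym2 V → N)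
    {K : Finset V} {k : ℕ} (hK : K.card = k) :
    (cliqueCoalition vp ep bp K).card < avgK' k := by
  have h1 : (K.image vp).card ≤ k := card_image_le.trans hK.le
  have h2 : ((K.offDiag.image Sym2.mk.uncurry).image ep).card ≤ k.choose 2 :=
    card_image_le.trans (by rw [Sym2.card_image_offDiag, hK])
  have h3 : (K.offDiag.image fun p => bp p.1 s(p.1, p.2)).card ≤ k * k - k :=
    card_image_le.trans (by rw [offDiag_card, hK])
  have h4 := two_mul_choose_two_add k
  rw [sq] at h4
  have h5 := card_union_le (K.image vp) ((K.offDiag.image Sym2.mk.uncurry).image ep)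
  have h6 := card_union_le (K.image vp ∪ (K.offDiag.image Sym2.mk.uncurry).image ep)
    (K.offDiag.image fun p => bp p.1 s(p.1, p.2))
  rw [cliqueCoalition, avgK']
  omega

end CliqueCoalition

namespace AvgEQReduction

section Clique

variable {V N : Type*} [Fintype V] [DecidableEq V] [Fintype N] [DecidableEq N]
  {H : SimpleGraph V} {k : ℕ} {G : SimpleGraph N} {Pv : V → Finset N} {Pe : Sym2 V → Finset N}
  {Pve : V → Sym2 V → Finset N} {vp : V → N} {ep : Sym2 V → N} {bp : V → Sym2 V → N}
  (R : AvgEQReduction H k G Pv Pe Pve vp ep bp) {K : Finset V}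

theorem vp_mem_cliqueCoalition {v : V} (hv : v ∈ K) : vp v ∈ cliqueCoalition vp ep bp K :=
  mem_cliqueCoalition.2 (.inl ⟨v, hv, rfl⟩)

theorem ep_mem_cliqueCoalition {u w : V} (hu : u ∈ K) (hw : w ∈ K) (hne : u ≠ w) :
    ep s(u, w) ∈ cliqueCoalition vp ep bp K :=
  mem_cliqueCoalition.2 (.inr (.inl ⟨u, hu, w, hw, hne, rfl⟩))

theorem bp_mem_cliqueCoalition {u w : V} (hu : u ∈ K) (hw : w ∈ K) (hne : u ≠ w) :
    bp u s(u, w) ∈ cliqueCoalition vp ep bp K :=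
  mem_cliqueCoalition.2 (.inr (.inr ⟨u, hu, w, hw, hne, rfl⟩))

variable (hK : H.IsNClique k K)
include R hK

theorem friendsIn_cliqueCoalition_vp {v : V} (hv : v ∈ K) :
    friendsIn G (cliqueCoalition vp ep bp K) (vp v) =
      (K.erase v).image fun w => bp v s(v, w) := by
  ext y
  simp only [mem_friendsIn, mem_image, mem_erase]
  constructor
  · rintro ⟨hy, hadj⟩
    have key := R.adj_of_mem_Pv (R.vp_mem v) hadj
    rcases mem_cliqueCoalition.1 hy with
      ⟨w, hw, rfl⟩ | ⟨u, hu, w, hw, hne, rfl⟩ | ⟨u, hu, w, hw, hne, rfl⟩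
    · rcases key with h | ⟨-, u, huv, h⟩
      · obtain rfl := R.Pv_inj h (R.vp_mem w)
        exact absurd hadj (G.loopless.irrefl _)
      · exact absurd h (R.vp_ne_bp w v huv (Sym2.mem_mk_left _ _))
    · have huw := hK.isClique hu hw hne
      rcases key with h | ⟨-, x, hvx, h⟩
      · exact absurd (R.ep_mem huw) (R.notMem_Pe huw h)
      · exact absurd h (R.ep_ne_bp v huw hvx (Sym2.mem_mk_left _ _))
    · have huw := hK.isClique hu hw hne
      rcases key with h | ⟨-, x, hvx, h⟩
      · exact absurd (R.bp_mem huw (Sym2.mem_mk_left _ _))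
          (R.notMem_Pve huw (Sym2.mem_mk_left _ _) h)
      · obtain ⟨rfl, rfl⟩ := R.bp_inj huw hvx h
        exact ⟨w, ⟨hne.symm, hw⟩, rfl⟩
  · rintro ⟨w, ⟨hne, hw⟩, rfl⟩
    exact ⟨bp_mem_cliqueCoalition hv hw hne.symm,
      (R.adj_bv v _ (hK.isClique hv hw hne.symm) (Sym2.mem_mk_left _ _)).symm⟩

theorem eq_ep_of_mem_cliqueCoalition {u w : V} (huw : H.Adj u w) :
    ∀ x ∈ cliqueCoalition vp ep bp K, x ∈ Pe s(u, w) → x = ep s(u, w) := by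
  intro x hx hxP
  rcases mem_cliqueCoalition.1 hx with
    ⟨v, hv, rfl⟩ | ⟨a, ha, b, hb, hne, rfl⟩ | ⟨a, ha, b, hb, hne, rfl⟩
  · exact absurd hxP (R.notMem_Pe huw (R.vp_mem v))
  · have hab := hK.isClique ha hb hne
    rw [R.Pe_inj hab huw (R.ep_mem hab) hxP]
  · have hab := hK.isClique ha hb hne
    exact absurd (R.bp_mem hab (Sym2.mem_mk_left _ _))
      (R.notMem_Pve_of_mem_Pe huw hab (Sym2.mem_mk_left _ _) hxP)

theorem eq_bp_of_mem_cliqueCoalition {u w : V} (huw : H.Adj u w) :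
    ∀ x ∈ cliqueCoalition vp ep bp K, x ∈ Pve u s(u, w) → x = bp u s(u, w) := by
  have hu := Sym2.mem_mk_left u w
  intro x hx hxP
  rcases mem_cliqueCoalition.1 hx with
    ⟨v, hv, rfl⟩ | ⟨a, ha, b, hb, hne, rfl⟩ | ⟨a, ha, b, hb, hne, rfl⟩
  · exact absurd hxP (R.notMem_Pve huw hu (R.vp_mem v))
  · have hab := hK.isClique ha hb hne
    exact absurd hxP (R.notMem_Pve_of_mem_Pe hab huw hu (R.ep_mem hab))
  · have hab := hK.isClique ha hb hne
    have ha' := Sym2.mem_mk_left a b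
    obtain ⟨rfl, h⟩ := R.Pve_inj hab ha' huw hu (R.bp_mem hab ha') hxP
    rw [h]

theorem friendsIn_cliqueCoalition_ep {u w : V} (hu : u ∈ K) (hw : w ∈ K) (hne : u ≠ w) :
    friendsIn G (cliqueCoalition vp ep bp K) (ep s(u, w)) =
      {bp u s(u, w), bp w s(u, w)} := by
  have huw := hK.isClique hu hw hne
  refine (R.friendsIn_ep_subset huw (R.eq_ep_of_mem_cliqueCoalition hK huw)).antisymm ?_
  intro y hy
  rw [mem_insert, mem_singleton] at hy
  rw [mem_friendsIn]
  rcases hy with rfl | rfl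
  · exact ⟨bp_mem_cliqueCoalition hu hw hne, (R.adj_be u _ huw (Sym2.mem_mk_left _ _)).symm⟩
  · refine ⟨?_, (R.adj_be w _ huw (Sym2.mem_mk_right _ _)).symm⟩
    rw [Sym2.eq_swap]
    exact bp_mem_cliqueCoalition hw hu hne.symm

theorem friendsIn_cliqueCoalition_bp {u w : V} (hu : u ∈ K) (hw : w ∈ K) (hne : u ≠ w) :
    friendsIn G (cliqueCoalition vp ep bp K) (bp u s(u, w)) = {vp u, ep s(u, w)} := by
  have huw := hK.isClique hu hw hne
  refine (R.friendsIn_bp_subset huw (R.eq_bp_of_mem_cliqueCoalition hK huw)).antisymm ?_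
  intro y hy
  rw [mem_insert, mem_singleton] at hy
  rw [mem_friendsIn]
  rcases hy with rfl | rfl
  · exact ⟨vp_mem_cliqueCoalition hu, R.adj_bv u _ huw (Sym2.mem_mk_left _ _)⟩
  · exact ⟨ep_mem_cliqueCoalition hu hw hne, R.adj_be u _ huw (Sym2.mem_mk_left _ _)⟩

theorem friendCount_cliqueCoalition_vp {v : V} (hv : v ∈ K) :
    friendCount G (cliqueCoalition vp ep bp K) (vp v) = k - 1 := by
  rw [friendCount, R.friendsIn_cliqueCoalition_vp hK hv, card_image_of_injOn,
    card_erase_of_mem hv, hK.card_eq]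
  intro a ha b hb h
  obtain ⟨ha, ha'⟩ := mem_erase.1 ha
  obtain ⟨hb, hb'⟩ := mem_erase.1 hb
  exact (R.bp_inj (hK.isClique hv ha' ha.symm) (hK.isClique hv hb' hb.symm) h).2

theorem friendCount_cliqueCoalition_ep {u w : V} (hu : u ∈ K) (hw : w ∈ K) (hne : u ≠ w) :
    friendCount G (cliqueCoalition vp ep bp K) (ep s(u, w)) = 2 := by
  rw [friendCount, R.friendsIn_cliqueCoalition_ep hK hu hw hne,
    card_pair (R.bp_ne_bp (hK.isClique hu hw hne))]

theorem friendCount_cliqueCoalition_bp {u w : V} (hu : u ∈ K) (hw : w ∈ K) (hne : u ≠ w) :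
    friendCount G (cliqueCoalition vp ep bp K) (bp u s(u, w)) = 2 := by
  rw [friendCount, R.friendsIn_cliqueCoalition_bp hK hu hw hne,
    card_pair (R.vp_ne_ep u (hK.isClique hu hw hne))]

theorem friendCountSum_cliqueCoalition_vp {v : V} (hv : v ∈ K) :
    friendCountSum G (cliqueCoalition vp ep bp K) (vp v) = 3 * (k - 1) := by
  have h : ∀ y ∈ friendsIn G (cliqueCoalition vp ep bp K) (vp v),
      friendCount G (cliqueCoalition vp ep bp K) y = 2 := by
    intro y hy
    rw [R.friendsIn_cliqueCoalition_vp hK hv] at hy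
    obtain ⟨w, hw, rfl⟩ := mem_image.1 hy
    obtain ⟨hne, hw⟩ := mem_erase.1 hw
    exact R.friendCount_cliqueCoalition_bp hK hv hw hne.symm
  have hcard : (friendsIn G (cliqueCoalition vp ep bp K) (vp v)).card = k - 1 :=
    R.friendCount_cliqueCoalition_vp hK hv
  rw [friendCountSum_eq, sum_congr rfl h, sum_const, hcard,
    R.friendCount_cliqueCoalition_vp hK hv, smul_eq_mul]
  ring

theorem friendCountSum_cliqueCoalition_ep {u w : V} (hu : u ∈ K) (hw : w ∈ K) (hne : u ≠ w) :
    friendCountSum G (cliqueCoalition vp ep bp K) (ep s(u, w)) = 6 := by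
  have h := R.friendCount_cliqueCoalition_bp hK hw hu hne.symm
  rw [Sym2.eq_swap] at h
  rw [friendCountSum_eq, R.friendsIn_cliqueCoalition_ep hK hu hw hne,
    sum_pair (R.bp_ne_bp (hK.isClique hu hw hne)), R.friendCount_cliqueCoalition_ep hK hu hw hne,
    R.friendCount_cliqueCoalition_bp hK hu hw hne, h]
  norm_num

theorem friendCountSum_cliqueCoalition_bp {u w : V} (hu : u ∈ K) (hw : w ∈ K) (hne : u ≠ w) :
    friendCountSum G (cliqueCoalition vp ep bp K) (bp u s(u, w)) = 2 + (k - 1 + 2) := by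
  rw [friendCountSum_eq, R.friendsIn_cliqueCoalition_bp hK hu hw hne,
    sum_pair (R.vp_ne_ep u (hK.isClique hu hw hne)),
    R.friendCount_cliqueCoalition_bp hK hu hw hne, R.friendCount_cliqueCoalition_vp hK hu,
    R.friendCount_cliqueCoalition_ep hK hu hw hne]

/-- The coalition of a `k`-clique blocks the gadget partition. -/
theorem blocks_cliqueCoalition (hk : 4 ≤ k) {Γ : CoalitionStructure N}
    (hΓ : IsAvgGamma H Pv Pe Pve Γ) : Blocks (utilAvgEQ G) Γ (cliqueCoalition vp ep bp K) := by
  have hcard : ((cliqueCoalition vp ep bp K).card : ℤ) < avgK' k := by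
    exact_mod_cast card_cliqueCoalition_lt vp ep bp hK.card_eq
  refine ⟨?_, fun x hx => ?_⟩
  · obtain ⟨v, hv⟩ := card_pos.1 (by rw [hK.card_eq]; omega : 0 < K.card)
    exact ⟨vp v, vp_mem_cliqueCoalition hv⟩
  rcases mem_cliqueCoalition.1 hx with
    ⟨v, hv, rfl⟩ | ⟨u, hu, w, hw, hne, rfl⟩ | ⟨u, hu, w, hw, hne, rfl⟩
  · obtain ⟨mid, fringe, hD⟩ := R.dome_v v
    rw [hΓ.1 v _ (R.vp_mem v), utilAvgEQ_lt_iff (R.vp_mem v) hx, (R.friendCount_vp v).1,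
      (R.friendCount_vp v).2, R.friendCount_cliqueCoalition_vp hK hv,
      R.friendCountSum_cliqueCoalition_vp hK hv, hD.card_eq, sub_self, mul_zero]
    exact mul_pos (by omega) (by positivity)
  · have huw := hK.isClique hu hw hne
    obtain ⟨mid, fringe, hD⟩ := R.dome_e _ (H.mem_edgeSet.2 huw)
    rw [hΓ.2.1 _ huw _ (R.ep_mem huw), utilAvgEQ_lt_iff (R.ep_mem huw) hx,
      (R.friendCount_ep huw).1, (R.friendCount_ep huw).2,
      R.friendCount_cliqueCoalition_ep hK hu hw hne,
      R.friendCountSum_cliqueCoalition_ep hK hu hw hne, hD.card_eq, sub_self, mul_zero]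
    exact mul_pos (by omega) (by positivity)
  · have huw := hK.isClique hu hw hne
    have hu' := Sym2.mem_mk_left u w
    obtain ⟨mid, fringe, hD⟩ := R.dome_ve _ _ (H.mem_edgeSet.2 huw) hu'
    rw [hΓ.2.2 _ _ huw hu' _ (R.bp_mem huw hu'), utilAvgEQ_lt_iff (R.bp_mem huw hu') hx,
      (R.friendCount_bp huw).1, (R.friendCount_bp huw).2,
      R.friendCount_cliqueCoalition_bp hK hu hw hne,
      R.friendCountSum_cliqueCoalition_bp hK hu hw hne, hD.card_eq]
    refine lt_of_le_of_lt (mul_nonpos_of_nonneg_of_nonpos (by positivity) ?_)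
      (mul_pos (sub_pos.2 hcard) (by positivity))
    push_cast [(by omega : 1 ≤ k)]
    linarith [(by exact_mod_cast hk : (4 : ℤ) ≤ k)]

end Clique

end AvgEQReduction

/-- In the avg-EQ reduction instance built from a graph `H` and `k ≥ 4` with
`|V| + |E| ≥ k²`, under avg-EQ utilities, the coalition structure `Γ` is not
core-stable iff `H` contains a clique of size `k`. -/
theorem avgEQ_not_coreStable_iff_clique {V N : Type*} [Fintype V] [DecidableEq V]
    [Fintype N] [DecidableEq N]
    (H : SimpleGraph V) (k : ℕ) (hk : 4 ≤ k)
    (hsize : k ^ 2 ≤ Fintype.card V + H.edgeFinset.card)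
    (G : SimpleGraph N) (Pv : V → Finset N) (Pe : Sym2 V → Finset N)
    (Pve : V → Sym2 V → Finset N)
    (vp : V → N) (ep : Sym2 V → N) (bp : V → Sym2 V → N)
    (R : AvgEQReduction H k G Pv Pe Pve vp ep bp)
    (Γ : CoalitionStructure N) (hΓ : IsAvgGamma H Pv Pe Pve Γ) :
    ¬ CoreStable (utilAvgEQ G) Γ ↔ ∃ K : Finset V, H.IsNClique k K := by
  rw [CoreStable, not_not]
  constructor
  · rintro ⟨C, hC⟩
    exact R.exists_isNClique_of_blocks hk hsize hΓ hC
  · rintro ⟨K, hK⟩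
    exact ⟨_, R.blocks_cliqueCoalition hK hk hΓ⟩
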